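/- arXiv:0805.1935 — 7 statements merged into one kernel-verified Lean document; each statement's English description precedes it below -/
import Mathlib

section
/- Let G be a limit group whose first betti number is n. Then every abelian subgroup of G has rank at most n: for every commutative subgroup A of G and every injective group homomorphism from the free abelian group ℤ^r into A, one has r ≤ n. -/
/-- A limit group: a finitely generated, fully residually free group. -/
def IsLimitGroup (G : Type*) [Group G] : Prop :=
  Group.FG G ∧ ∀ S : Finset G, (∀ s ∈ S, s ≠ 1) →
    ∃ f : G →* FreeGroup (Fin 2), ∀ s ∈ S, f s ≠ 1

open TensorProduct in
/-- The first betti number of a group: the rank of its abelianization modulo torsion,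
computed as `dim_ℚ (G^{ab} ⊗_ℤ ℚ)`. -/
noncomputable def firstBetti (G : Type*) [Group G] : ℕ :=
  Module.finrank ℚ (ℚ ⊗[ℤ] Additive (Abelianization G))

/-- A crossed homomorphism (derivation) `d : H → M` with respect to a homomorphism `f : H →* R`
and an `R`-module `M`. -/
def IsCrossedHom {H R M : Type*} [Group H] [Ring R] [AddCommGroup M] [Module R M]
    (f : H →* R) (d : H → M) : Prop :=
  ∀ g h, d (g * h) = d g + f g • d h

namespace IsCrossedHom

variable {H R M : Type*} [Group H] [Ring R] [AddCommGroup M] [Module R M]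
  {f : H →* R} {d : H → M}

theorem map_one (hd : IsCrossedHom f d) : d 1 = 0 := by
  have h := hd 1 1
  simpa using h

theorem map_inv (hd : IsCrossedHom f d) (g : H) : d g⁻¹ = - (f g⁻¹ • d g) := by
  have h := hd g⁻¹ g
  rw [inv_mul_cancel, hd.map_one] at h
  exact eq_neg_of_add_eq_zero_left h.symm

theorem map_zpow (hd : IsCrossedHom f d) {c : H} (hc : f c = 1) (m : ℤ) :
    d (c ^ m) = m • d c := by
  have hinv : f c⁻¹ = 1 := by
    have h := f.map_mul c⁻¹ c
    rw [inv_mul_cancel, _root_.map_one, hc, mul_one] at h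
    exact h.symm
  have hz : ∀ m : ℤ, f (c ^ m) = 1 := by
    intro m
    induction m with
    | zero => simp
    | succ n ih => rw [zpow_add_one, map_mul, ih, hc, one_mul]
    | pred n ih => rw [zpow_sub_one, map_mul, ih, hinv, one_mul]
  induction m with
  | zero => simp [hd.map_one]
  | succ n ih => rw [zpow_add_one, hd, ih, hz, one_smul, add_smul, one_smul]
  | pred n ih =>
    rw [zpow_sub_one, hd, ih, hz, one_smul, hd.map_inv, hinv, one_smul, sub_smul, one_smul,
      sub_eq_add_neg]

theorem comp (hd : IsCrossedHom f d) {K : Type*} [Group K] (φ : K →* H) :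
    IsCrossedHom (f.comp φ) (d ∘ φ) := fun g h => by
  simp [hd (φ g) (φ h)]

theorem ext {α : Type*} {f : FreeGroup α →* R} {d d' : FreeGroup α → M}
    (hd : IsCrossedHom f d) (hd' : IsCrossedHom f d')
    (h : ∀ i, d (FreeGroup.of i) = d' (FreeGroup.of i)) (g : FreeGroup α) : d g = d' g := by
  induction g using FreeGroup.induction_on with
  | C1 => rw [hd.map_one, hd'.map_one]
  | of i => exact h i
  | inv_of i hi =>
    have := h i
    change d (FreeGroup.of i)⁻¹ = d' (FreeGroup.of i)⁻¹
    rw [hd.map_inv, hd'.map_inv, this]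
  | mul x y hx hy => rw [hd, hd', hx, hy]

theorem exists_of {α : Type*} (f : FreeGroup α →* R) (e : α → M) :
    ∃ d : FreeGroup α → M, IsCrossedHom f d ∧ ∀ i, d (FreeGroup.of i) = e i := by
  let P : FreeGroup α →* Equiv.Perm M := FreeGroup.lift fun i =>
    (MulAction.toPerm (f.toHomUnits (FreeGroup.of i)) : Equiv.Perm M).trans (Equiv.addRight (e i))
  have hP : ∀ g x, P g x = f g • x + P g 0 := by
    intro g
    induction g using FreeGroup.induction_on with
    | C1 => simp
    | of i => intro x; simp [P, Units.smul_def]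
    | inv_of i hi =>
      intro x
      have key : P (FreeGroup.of i) (f (FreeGroup.of i)⁻¹ • x + P (FreeGroup.of i)⁻¹ 0) = x := by
        rw [hi, smul_add, add_assoc, ← hi, smul_smul, ← map_mul, mul_inv_cancel,
          _root_.map_one, one_smul, _root_.map_inv, ← Equiv.Perm.mul_apply, mul_inv_cancel]
        simp
      rw [_root_.map_inv, Equiv.Perm.inv_eq_iff_eq, ← _root_.map_inv]
      exact key.symm
    | mul a b ha hb =>
      intro x
      rw [map_mul, Equiv.Perm.mul_apply, Equiv.Perm.mul_apply, ha, hb x, ha (P b 0), map_mul,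
        smul_add, smul_smul, add_assoc]
  refine ⟨fun g => P g 0, fun g h => ?_, fun i => by simp [P]⟩
  simp only [map_mul, Equiv.Perm.mul_apply]
  rw [hP, add_comm]

end IsCrossedHom

section Fox

variable {α : Type*} [DecidableEq α]

/-- The vector of Fox derivatives of a word of a free group. -/
noncomputable def foxDeriv : FreeGroup α → α → MonoidAlgebra ℤ (FreeGroup α) :=
  (IsCrossedHom.exists_of (MonoidAlgebra.of ℤ (FreeGroup α))
    (fun i => Pi.single i (1 : MonoidAlgebra ℤ (FreeGroup α)))).choose

theorem isCrossedHom_foxDeriv :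
    IsCrossedHom (MonoidAlgebra.of ℤ (FreeGroup α)) (foxDeriv (α := α)) :=
  (IsCrossedHom.exists_of (MonoidAlgebra.of ℤ (FreeGroup α)) _).choose_spec.1

theorem foxDeriv_of (i : α) : foxDeriv (FreeGroup.of i) = Pi.single i 1 :=
  (IsCrossedHom.exists_of (MonoidAlgebra.of ℤ (FreeGroup α)) _).choose_spec.2 i

/-- The chain rule of Fox calculus. -/
theorem IsCrossedHom.eq_sum_foxDeriv [Fintype α] {R M : Type*} [Ring R] [AddCommGroup M]
    [Module R M] {f : FreeGroup α →* R} {d : FreeGroup α → M} (hd : IsCrossedHom f d)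
    (w : FreeGroup α) :
    d w = ∑ i, MonoidAlgebra.lift ℤ R (FreeGroup α) f (foxDeriv w i) • d (FreeGroup.of i) := by
  refine hd.ext (d' := fun w => ∑ i, MonoidAlgebra.lift ℤ R (FreeGroup α) f (foxDeriv w i) •
    d (FreeGroup.of i)) (fun g h => ?_) (fun i => ?_) w
  · simp only [isCrossedHom_foxDeriv g h, Pi.add_apply, Pi.smul_apply, smul_eq_mul, map_add,
      map_mul, add_smul, mul_smul, Finset.sum_add_distrib, Finset.smul_sum, MonoidAlgebra.lift_of]
  · rw [foxDeriv_of, Finset.sum_eq_single i]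
    · simp
    · intro j _ hj
      simp [Pi.single_eq_of_ne hj]
    · simp

/-- The vector of exponent sums of a word of a free group. -/
def exponentSum : FreeGroup α →* Multiplicative (α → ℤ) :=
  FreeGroup.lift fun i => Multiplicative.ofAdd (Pi.single i 1)

theorem lift_one_foxDeriv [Fintype α] (w : FreeGroup α) (i : α) :
    MonoidAlgebra.lift ℤ ℤ (FreeGroup α) 1 (foxDeriv w i) = (exponentSum w).toAdd i := by
  have hd : IsCrossedHom (1 : FreeGroup α →* ℤ)
      (fun w : FreeGroup α => (exponentSum w).toAdd) := fun g h => by simp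
  have h := hd.eq_sum_foxDeriv w
  rw [h]
  simp [exponentSum, Finset.sum_apply, Pi.single_apply]

end Fox

section ResiduallyP

/-- A group is residually `p` if any finite subset embeds into a finite `p`-group quotient. -/
def IsResiduallyPGroup (p : ℕ) (Γ : Type*) [Group Γ] : Prop :=
  ∀ T : Finset Γ, ∃ (Q : Type) (_ : Group Q) (_ : Finite Q) (q : Γ →* Q),
    IsPGroup p Q ∧ Set.InjOn q T

theorem MonoidAlgebra.coeff_mul_one_of_const {k Q : Type*} [CommRing k] [Group Q]
    {v : MonoidAlgebra k Q} {a : k} (hv : ∀ g, v.coeff g = a) (x : MonoidAlgebra k Q) :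
    (v * x).coeff 1 = a * MonoidAlgebra.lift k k Q 1 x := by
  induction x using MonoidAlgebra.induction_on with
  | of m => simp [MonoidAlgebra.of_apply, MonoidAlgebra.coeff_mul_single_apply, hv]
  | add x y hx hy => simp [mul_add, hx, hy]
  | smul r x hx => simp [hx]; ring

/-- Over a field of characteristic `p` and a finite `p`-group, a matrix whose augmentation
has a right inverse up to a nonzero scalar has trivial left kernel. -/
theorem MonoidAlgebra.eq_zero_of_sum_mul_eq_zero_of_isPGroup {p : ℕ} [Fact p.Prime]
    {Q κ ι : Type*} [Group Q] [Finite Q] (hQ : IsPGroup p Q) [Fintype κ] [Fintype ι]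
    [DecidableEq κ]
    (M : κ → ι → MonoidAlgebra (ZMod p) Q) (X : ι → κ → ZMod p) {δ : ZMod p} (hδ : δ ≠ 0)
    (hM : ∀ l m, ∑ i, MonoidAlgebra.lift (ZMod p) (ZMod p) Q 1 (M l i) * X i m =
      if l = m then δ else 0)
    (v : κ → MonoidAlgebra (ZMod p) Q) (hv : ∀ i, ∑ l, v l * M l i = 0) : v = 0 := by
  let V : Submodule (ZMod p) (κ → MonoidAlgebra (ZMod p) Q) :=
    { carrier := {v | ∀ i, ∑ l, v l * M l i = 0}
      add_mem' := fun {a b} ha hb i => by simp [add_mul, Finset.sum_add_distrib, ha i, hb i]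
      zero_mem' := fun i => by simp
      smul_mem' := fun c a ha i => by simp [← Finset.smul_sum, ha i] }
  let act : MulAction Q V :=
    { smul := fun q v => ⟨fun l => MonoidAlgebra.of (ZMod p) Q q * v.1 l, fun i => by
        have h := v.2 i
        simp only [mul_assoc, ← Finset.mul_sum, h, mul_zero]⟩
      one_smul := fun v => Subtype.ext <| funext fun l => by
        change MonoidAlgebra.of (ZMod p) Q 1 * v.1 l = v.1 l
        rw [map_one, one_mul]
      mul_smul := fun a b v => Subtype.ext <| funext fun l => by
        change MonoidAlgebra.of (ZMod p) Q (a * b) * v.1 l =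
          MonoidAlgebra.of (ZMod p) Q a * (MonoidAlgebra.of (ZMod p) Q b * v.1 l)
        rw [map_mul, mul_assoc] }
  have hact : ∀ (q : Q) (v : V) l, (q • v).1 l = MonoidAlgebra.of (ZMod p) Q q * v.1 l :=
    fun _ _ _ => rfl
  have : Finite (MonoidAlgebra (ZMod p) Q) :=
    Finite.of_equiv (Q → ZMod p)
      (Finsupp.equivFunOnFinite.symm.trans MonoidAlgebra.coeffEquiv.symm)
  have : Finite V := inferInstance
  by_contra hne
  have hVnt : Nontrivial V := ⟨⟨⟨v, hv⟩, 0, fun h => hne (congrArg Subtype.val h)⟩⟩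
  have hdvd : p ∣ Nat.card V := by
    rw [Module.natCard_eq_pow_finrank (K := ZMod p) (V := V), Nat.card_zmod]
    exact dvd_pow_self _ Module.finrank_pos.ne'
  have h0 : (0 : V) ∈ MulAction.fixedPoints Q V := fun q => Subtype.ext <| funext fun l => by
    rw [hact]; simp
  obtain ⟨b, hb, hb0⟩ := hQ.exists_fixed_point_of_prime_dvd_card_of_fixed_point V hdvd h0
  have hconst : ∀ l g, (b.1 l).coeff g = (b.1 l).coeff 1 := fun l g => by
    have h := hact g b l
    rw [hb g] at h
    conv_lhs => rw [h]
    rw [MonoidAlgebra.of_apply, MonoidAlgebra.coeff_single_mul_apply, one_mul, inv_mul_cancel]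
  apply hb0
  symm
  refine Subtype.ext <| funext fun m => ?_
  have hsum : ∀ i, ∑ l, (b.1 l).coeff 1 *
      MonoidAlgebra.lift (ZMod p) (ZMod p) Q 1 (M l i) = 0 := fun i => by
    have h := congrArg (fun x => MonoidAlgebra.coeff x 1) (b.2 i)
    simpa [MonoidAlgebra.coeff_sum, MonoidAlgebra.coeff_mul_one_of_const (hconst _)] using h
  have hz : (b.1 m).coeff 1 * δ = 0 := by
    calc (b.1 m).coeff 1 * δ = ∑ l, (b.1 l).coeff 1 * (if l = m then δ else 0) := by simp
      _ = ∑ i, (∑ l, (b.1 l).coeff 1 *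
          MonoidAlgebra.lift (ZMod p) (ZMod p) Q 1 (M l i)) * X i m := by
        simp_rw [← hM, Finset.mul_sum, Finset.sum_mul]
        rw [Finset.sum_comm]
        simp only [mul_assoc]
      _ = 0 := by simp [hsum]
  have hz' := (mul_eq_zero.mp hz).resolve_right hδ
  ext g
  simp [hconst m g, hz']

/-- The reduction of an integral group ring to the mod `p` group ring of a quotient. -/
noncomputable def MonoidAlgebra.reduction (p : ℕ) {Γ Q : Type*} [Group Γ] [Group Q] (q : Γ →* Q) :
    MonoidAlgebra ℤ Γ →ₐ[ℤ] MonoidAlgebra (ZMod p) Q :=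
  MonoidAlgebra.lift ℤ _ Γ ((MonoidAlgebra.of (ZMod p) Q).comp q)

theorem MonoidAlgebra.lift_one_reduction (p : ℕ) {Γ Q : Type*} [Group Γ] [Group Q] (q : Γ →* Q)
    (x : MonoidAlgebra ℤ Γ) :
    MonoidAlgebra.lift (ZMod p) (ZMod p) Q 1 (MonoidAlgebra.reduction p q x) =
      ((MonoidAlgebra.lift ℤ ℤ Γ 1 x : ℤ) : ZMod p) := by
  induction x using MonoidAlgebra.induction_on with
  | of m => simp [MonoidAlgebra.reduction]
  | add x y hx hy => simp [hx, hy]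
  | smul r x hx => simp [hx]

theorem MonoidAlgebra.coeff_reduction (p : ℕ) {Γ Q : Type*} [Group Γ] [Group Q] (q : Γ →* Q)
    (x : MonoidAlgebra ℤ Γ) {T : Finset Γ} (hT : x.coeff.support ⊆ T) (hq : Set.InjOn q T)
    {g : Γ} (hg : g ∈ T) :
    (MonoidAlgebra.reduction p q x).coeff (q g) = (x.coeff g : ZMod p) := by
  classical
  rw [MonoidAlgebra.reduction, MonoidAlgebra.lift_apply, Finsupp.sum_of_support_subset _ hT _
    (by simp), MonoidAlgebra.coeff_sum, Finsupp.finsetSum_apply, Finset.sum_eq_single g]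
  · simp [MonoidAlgebra.of_apply]
  · intro b hb hbg
    have : q b ≠ q g := fun h => hbg (hq hb hg h)
    simp [MonoidAlgebra.of_apply, this]
  · exact fun h => absurd hg h

theorem MonoidAlgebra.dvd_coeff_of_sum_mul_eq_zero {p : ℕ} [Fact p.Prime]
    {Γ κ ι : Type*} [Group Γ] (hΓ : IsResiduallyPGroup p Γ) [Fintype κ] [Fintype ι]
    [DecidableEq κ]
    (M : κ → ι → MonoidAlgebra ℤ Γ) (X : ι → κ → ℤ) {δ : ℤ} (hδ : ¬ (p : ℤ) ∣ δ)
    (hM : ∀ l m, ∑ i, MonoidAlgebra.lift ℤ ℤ Γ 1 (M l i) * X i m = if l = m then δ else 0)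
    (y : κ → MonoidAlgebra ℤ Γ) (hy : ∀ i, ∑ l, y l * M l i = 0) (l : κ) (g : Γ) :
    (p : ℤ) ∣ (y l).coeff g := by
  classical
  obtain ⟨Q, _, _, q, hQ, hq⟩ := hΓ (insert g (y l).coeff.support)
  have hδ' : (δ : ZMod p) ≠ 0 := fun h => hδ ((ZMod.intCast_zmod_eq_zero_iff_dvd _ _).mp h)
  have h := MonoidAlgebra.eq_zero_of_sum_mul_eq_zero_of_isPGroup hQ
    (fun l i => reduction p q (M l i)) (fun i m => (X i m : ZMod p)) hδ'
    (fun l m => by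
      have := congrArg (Int.cast : ℤ → ZMod p) (hM l m)
      simp only [lift_one_reduction]
      push_cast at this
      simpa using this)
    (fun l => reduction p q (y l))
    (fun i => by simpa using congrArg (reduction p q) (hy i))
  have h1 := congrFun h l
  rw [← ZMod.intCast_zmod_eq_zero_iff_dvd,
    ← coeff_reduction p q (y l) (Finset.subset_insert g _) hq (Finset.mem_insert_self _ _)]
  rw [show reduction p q (y l) = 0 from h1]
  simp

/-- Over the integral group ring of a residually `p` group, a matrix whose augmentation
has a right inverse up to a scalar prime to `p` has trivial left kernel. -/
theorem MonoidAlgebra.eq_zero_of_sum_mul_eq_zero {p : ℕ} [Fact p.Prime]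
    {Γ κ ι : Type*} [Group Γ] (hΓ : IsResiduallyPGroup p Γ) [Fintype κ] [Fintype ι]
    [DecidableEq κ]
    (M : κ → ι → MonoidAlgebra ℤ Γ) (X : ι → κ → ℤ) {δ : ℤ} (hδ : ¬ (p : ℤ) ∣ δ)
    (hM : ∀ l m, ∑ i, MonoidAlgebra.lift ℤ ℤ Γ 1 (M l i) * X i m = if l = m then δ else 0)
    (y : κ → MonoidAlgebra ℤ Γ) (hy : ∀ i, ∑ l, y l * M l i = 0) : y = 0 := by
  have hp : (p : ℤ) ≠ 0 := by exact_mod_cast (Fact.out : p.Prime).ne_zero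
  have key : ∀ e : ℕ, ∀ y : κ → MonoidAlgebra ℤ Γ, (∀ i, ∑ l, y l * M l i = 0) →
      ∀ l g, (p : ℤ) ^ e ∣ (y l).coeff g := by
    intro e
    induction e with
    | zero => simp
    | succ e ih =>
      intro y hy l g
      let y' : κ → MonoidAlgebra ℤ Γ := fun l =>
        .ofCoeff ((y l).coeff.mapRange (· / (p : ℤ)) (by simp))
      have hyy' : ∀ l, y l = (p : ℤ) • y' l := fun l => by
        ext g
        have := MonoidAlgebra.dvd_coeff_of_sum_mul_eq_zero hΓ M X hδ hM y hy l g
        rw [MonoidAlgebra.coeff_smul_apply, smul_eq_mul]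
        simp [y', Int.mul_ediv_cancel' this]
      have hy' : ∀ i, ∑ l, y' l * M l i = 0 := fun i => by
        have h := hy i
        simp only [hyy', smul_mul_assoc, ← Finset.smul_sum] at h
        exact (smul_eq_zero.mp h).resolve_left hp
      rw [hyy' l, MonoidAlgebra.coeff_smul_apply, smul_eq_mul, pow_succ']
      exact mul_dvd_mul_left _ (ih y' hy' l g)
  funext l
  ext g
  have h := key ((y l).coeff g).natAbs y hy l g
  by_contra hne
  have hpos : 0 < ((y l).coeff g).natAbs := Int.natAbs_pos.mpr hne
  have h2 := Int.natAbs_dvd_natAbs.mpr h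
  rw [Int.natAbs_pow, Int.natAbs_natCast] at h2
  exact absurd (Nat.le_of_dvd hpos h2)
    (not_le.mpr (Nat.lt_pow_self (Fact.out : p.Prime).one_lt))

end ResiduallyP

section Siegel

open scoped Pointwise

variable {F Γ : Type*} [Group F] [Group Γ]

/-- The ring homomorphism of integral group rings induced by a group homomorphism. -/
noncomputable def groupRingMap (ψ : F →* Γ) : MonoidAlgebra ℤ F →ₐ[ℤ] MonoidAlgebra ℤ Γ :=
  MonoidAlgebra.lift ℤ _ F ((MonoidAlgebra.of ℤ Γ).comp ψ)

theorem lift_groupRingMap {R : Type*} [Ring R] (g : Γ →* R) (ψ : F →* Γ) (x : MonoidAlgebra ℤ F) :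
    MonoidAlgebra.lift ℤ R Γ g (groupRingMap ψ x) = MonoidAlgebra.lift ℤ R F (g.comp ψ) x := by
  induction x using MonoidAlgebra.induction_on with
  | of m => simp [groupRingMap]
  | add x y hx hy => simp [hx, hy]
  | smul r x hx => simp [hx]

theorem coeff_mul_groupRingMap (ψ : F →* Γ) (y : MonoidAlgebra ℤ Γ) (x : MonoidAlgebra ℤ F)
    (h : Γ) : (y * groupRingMap ψ x).coeff h =
      ∑ w ∈ x.coeff.support, y.coeff (h * (ψ w)⁻¹) * x.coeff w := by
  rw [groupRingMap, MonoidAlgebra.lift_apply, Finsupp.sum, Finset.mul_sum,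
    MonoidAlgebra.coeff_sum, Finsupp.finsetSum_apply]
  refine Finset.sum_congr rfl fun w _ => ?_
  simp [MonoidAlgebra.of_apply, MonoidAlgebra.coeff_mul_single_apply, mul_comm]

theorem siegel_card_lt {c b m n J I : ℕ} (hb : c ^ (2 * J + 1) < b) (hm : 0 < m)
    (hn : 2 * J * n ≤ (2 * J + 1) * m) (hI : J < I) (hc : 0 < c) :
    (b * c) ^ (J * n) < b ^ (I * m) := by
  have hb1 : 1 ≤ b := by omega
  have hbc : 1 ≤ b * c := Nat.mul_pos hb1 hc
  have h1 : ((b * c) ^ (J * n)) ^ 2 < (b ^ (I * m)) ^ 2 := by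
    calc ((b * c) ^ (J * n)) ^ 2 = (b * c) ^ (2 * J * n) := by rw [← pow_mul]; ring_nf
      _ ≤ (b * c) ^ ((2 * J + 1) * m) := Nat.pow_le_pow_right hbc hn
      _ = b ^ ((2 * J + 1) * m) * (c ^ (2 * J + 1)) ^ m := by rw [mul_pow, ← pow_mul]
      _ < b ^ ((2 * J + 1) * m) * b ^ m :=
        Nat.mul_lt_mul_of_pos_left (Nat.pow_lt_pow_left hb hm.ne') (Nat.pow_pos hb1)
      _ = b ^ ((J + 1) * m * 2) := by rw [← pow_add]; ring_nf
      _ ≤ b ^ (I * m * 2) := Nat.pow_le_pow_right hb1 (by gcongr; omega)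
      _ = (b ^ (I * m)) ^ 2 := by rw [← pow_mul]
  exact lt_of_pow_lt_pow_left₀ 2 (Nat.zero_le _) h1

/-- A Siegel lemma over the integral group ring of an amenable group: an underdetermined system
has a nonzero solution with coefficients bounded independently of the quotient map `ψ`. -/
theorem exists_ne_zero_sum_mul_groupRingMap_eq_zero {ι J : Type*} [Fintype ι] [Fintype J]
    [DecidableEq Γ] (ψ : F →* Γ) (E : ι → J → MonoidAlgebra ℤ F) {C : ℕ}
    (hC : ∀ j, ∑ i, ∑ w ∈ (E i j).coeff.support, |(E i j).coeff w| ≤ C)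
    (hcard : Fintype.card J < Fintype.card ι) {b : ℕ}
    (hb : (2 * C + 1) ^ (2 * Fintype.card J + 1) < b) {S B : Finset Γ}
    (hS : ∀ i j, ∀ w ∈ (E i j).coeff.support, ψ w ∈ S) (hB : B.Nonempty)
    (hBS : 2 * Fintype.card J * (B * S).card ≤ (2 * Fintype.card J + 1) * B.card) :
    ∃ y : ι → MonoidAlgebra ℤ Γ, y ≠ 0 ∧ (∀ i g, |(y i).coeff g| < b) ∧
      ∀ j, ∑ i, y i * groupRingMap ψ (E i j) = 0 := by
  classical
  let z : (ι × B → Fin b) → ι → MonoidAlgebra ℤ Γ := fun Y i => .ofCoeff <|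
    Finsupp.onFinset B (fun g => if h : g ∈ B then ((Y (i, ⟨g, h⟩) : ℕ) : ℤ) else 0)
      (fun g hg => by by_contra h; simp [h] at hg)
  have hz : ∀ Y i g, (z Y i).coeff g = if h : g ∈ B then ((Y (i, ⟨g, h⟩) : ℕ) : ℤ) else 0 :=
    fun _ _ _ => rfl
  have hz0 : ∀ Y i g, 0 ≤ (z Y i).coeff g := fun Y i g => by
    rw [hz]; split_ifs <;> positivity
  have hb1 : 0 < b := by omega
  have hzb : ∀ Y i g, (z Y i).coeff g < b := fun Y i g => by
    rw [hz]; split_ifs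
    · exact_mod_cast Fin.is_lt _
    · exact_mod_cast hb1
  have hbound : ∀ Y j h, |(∑ i, z Y i * groupRingMap ψ (E i j)).coeff h| ≤ b * C := by
    intro Y j h
    rw [MonoidAlgebra.coeff_sum, Finsupp.finsetSum_apply]
    calc |∑ i, (z Y i * groupRingMap ψ (E i j)).coeff h|
        ≤ ∑ i, |(z Y i * groupRingMap ψ (E i j)).coeff h| := Finset.abs_sum_le_sum_abs _ _
      _ ≤ ∑ i, ∑ w ∈ (E i j).coeff.support, (b : ℤ) * |(E i j).coeff w| := by
        refine Finset.sum_le_sum fun i _ => ?_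
        rw [coeff_mul_groupRingMap]
        refine (Finset.abs_sum_le_sum_abs _ _).trans (Finset.sum_le_sum fun w _ => ?_)
        rw [abs_mul, abs_of_nonneg (hz0 _ _ _)]
        exact mul_le_mul_of_nonneg_right (hzb _ _ _).le (abs_nonneg _)
      _ = b * ∑ i, ∑ w ∈ (E i j).coeff.support, |(E i j).coeff w| := by
        simp [Finset.mul_sum]
      _ ≤ b * C := mul_le_mul_of_nonneg_left (hC j) (by positivity)
  let T : (ι × B → Fin b) → (J × (B * S : Finset Γ) → Finset.Icc (-(b * C : ℤ)) (b * C)) :=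
    fun Y p => ⟨(∑ i, z Y i * groupRingMap ψ (E i p.1)).coeff p.2, by
      rw [Finset.mem_Icc]; exact abs_le.mp (hbound Y p.1 p.2)⟩
  have hlt : Fintype.card (J × (B * S : Finset Γ) → Finset.Icc (-(b * C : ℤ)) (b * C)) <
      Fintype.card (ι × B → Fin b) := by
    simp only [Fintype.card_fun, Fintype.card_prod, Fintype.card_coe, Fintype.card_fin,
      Int.card_Icc]
    refine lt_of_le_of_lt (Nat.pow_le_pow_left ?_ _)
      (siegel_card_lt hb hB.card_pos hBS hcard (Nat.succ_pos _))
    have : ((b * C : ℤ) + 1 - -(b * C)).toNat = 2 * (b * C) + 1 := by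
      rw [show (b * C : ℤ) + 1 - -(b * C) = ((2 * (b * C) + 1 : ℕ) : ℤ) by push_cast; ring,
        Int.toNat_natCast]
    rw [this]
    nlinarith
  obtain ⟨Y, Y', hne, hT⟩ := Fintype.exists_ne_map_eq_of_card_lt T hlt
  refine ⟨fun i => z Y i - z Y' i, ?_, fun i g => ?_, fun j => ?_⟩
  · intro h0
    apply hne
    funext ⟨i, g, hg⟩
    have h1 := congrFun h0 i
    rw [Pi.zero_apply, sub_eq_zero] at h1
    have h2 := congrArg (fun x => MonoidAlgebra.coeff x g) h1
    simp only [hz, hg, dite_true] at h2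
    exact Fin.ext (by exact_mod_cast h2)
  · rw [MonoidAlgebra.coeff_sub, Finsupp.sub_apply, abs_lt]
    have := hz0 Y i g
    have := hz0 Y' i g
    have := hzb Y i g
    have := hzb Y' i g
    constructor <;> linarith
  · simp only [sub_mul, Finset.sum_sub_distrib]
    rw [sub_eq_zero]
    ext h
    by_cases hh : h ∈ B * S
    · exact congrArg Subtype.val (congrFun hT (j, ⟨h, hh⟩))
    · have hzero : ∀ Y, (∑ i, z Y i * groupRingMap ψ (E i j)).coeff h = 0 := fun Y => by
        rw [MonoidAlgebra.coeff_sum, Finsupp.finsetSum_apply]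
        refine Finset.sum_eq_zero fun i _ => ?_
        rw [coeff_mul_groupRingMap]
        refine Finset.sum_eq_zero fun w hw => ?_
        rw [hz, dif_neg, zero_mul]
        intro hmem
        exact hh (Finset.mem_mul.mpr ⟨_, hmem, _, hS i j w hw, by simp⟩)
      rw [hzero, hzero]

end Siegel

section Unitriangular

/-- Upper triangular integer matrices with ones on the diagonal. -/
def IsUnitriangular {k : ℕ} (M : Matrix (Fin k) (Fin k) ℤ) : Prop :=
  (∀ a b, b < a → M a b = 0) ∧ ∀ a, M a a = 1

theorem IsUnitriangular.mul {k : ℕ} {M N : Matrix (Fin k) (Fin k) ℤ} (hM : IsUnitriangular M)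
    (hN : IsUnitriangular N) : IsUnitriangular (M * N) := by
  refine ⟨fun a b hab => ?_, fun a => ?_⟩
  · rw [Matrix.mul_apply]
    refine Finset.sum_eq_zero fun c _ => ?_
    rcases lt_or_ge c a with h | h
    · rw [hM.1 a c h, zero_mul]
    · rw [hN.1 c b (hab.trans_le h), mul_zero]
  · rw [Matrix.mul_apply, Finset.sum_eq_single a]
    · rw [hM.2, hN.2, one_mul]
    · intro c _ hc
      rcases lt_or_gt_of_ne hc with h | h
      · rw [hM.1 a c h, zero_mul]
      · rw [hN.1 c a h, mul_zero]
    · simp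

/-- The group of integer unitriangular matrices of size `k`. -/
def unitriangular (k : ℕ) : Subgroup (Matrix (Fin k) (Fin k) ℤ)ˣ where
  carrier := {u | IsUnitriangular u.1 ∧ IsUnitriangular (u⁻¹).1}
  mul_mem' := fun {a b} ha hb => ⟨by simpa using ha.1.mul hb.1, by
    rw [mul_inv_rev]; simpa using hb.2.mul ha.2⟩
  one_mem' := by
    have h : IsUnitriangular (1 : Matrix (Fin k) (Fin k) ℤ) :=
      ⟨fun a b hab => Matrix.one_apply_ne hab.ne', fun a => Matrix.one_apply_eq a⟩
    simpa using h
  inv_mem' := fun {a} ha => ⟨ha.2, by simpa using ha.1⟩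

variable {k : ℕ}

/-- The matrix of an element of the unitriangular group. -/
def unitriangular.toMatrix : unitriangular k →* Matrix (Fin k) (Fin k) ℤ :=
  (Units.coeHom _).comp (unitriangular k).subtype

namespace unitriangular

theorem isUnitriangular (g : unitriangular k) : IsUnitriangular (toMatrix g) := g.2.1

theorem toMatrix_injective : Function.Injective (toMatrix (k := k)) := fun _ _ hgh =>
  Subtype.ext (Units.ext hgh)

/-- The entries of a unitriangular matrix, ordered lexicographically, by columns from left to
right and in each column from bottom to top. -/
def lexKey (g : unitriangular k) : Lex ((Fin k ×ₗ (Fin k)ᵒᵈ) → ℤ) :=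
  toLex fun x => toMatrix g (OrderDual.ofDual (ofLex x).2) (ofLex x).1

theorem lexKey_injective : Function.Injective (lexKey (k := k)) := fun _ _ hgh =>
  toMatrix_injective <| Matrix.ext fun a b =>
    congrFun (congrArg ofLex hgh) (toLex (b, OrderDual.toDual a))

theorem lexKey_mul_lt (s : unitriangular k) {g h : unitriangular k} (hgh : lexKey g < lexKey h) :
    lexKey (s * g) < lexKey (s * h) := by
  obtain ⟨x, hx, hlt⟩ := hgh
  have hentry : ∀ a b, toMatrix (s * h) a b - toMatrix (s * g) a b =
      ∑ c, toMatrix s a c * (toMatrix h c b - toMatrix g c b) := fun a b => by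
    simp only [map_mul, Matrix.mul_apply, mul_sub, Finset.sum_sub_distrib]
  have hvanish : ∀ y : Fin k ×ₗ (Fin k)ᵒᵈ, y < x →
      toMatrix h (OrderDual.ofDual (ofLex y).2) (ofLex y).1 -
      toMatrix g (OrderDual.ofDual (ofLex y).2) (ofLex y).1 = 0 := fun y hy =>
    sub_eq_zero.mpr (hx y hy).symm
  refine ⟨x, fun y hy => ?_, ?_⟩
  · change toMatrix (s * g) (OrderDual.ofDual (ofLex y).2) (ofLex y).1 =
      toMatrix (s * h) (OrderDual.ofDual (ofLex y).2) (ofLex y).1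
    symm
    rw [← sub_eq_zero, hentry]
    refine Finset.sum_eq_zero fun c _ => ?_
    rcases lt_or_ge c (OrderDual.ofDual (ofLex y).2) with hc | hc
    · rw [(isUnitriangular s).1 _ _ hc, zero_mul]
    · have h1 : toLex ((ofLex y).1, OrderDual.toDual c) ≤ y := by
        rw [Prod.Lex.le_iff]
        exact Or.inr ⟨rfl, hc⟩
      have h2 := hvanish _ (h1.trans_lt hy)
      simp only [ofLex_toLex, OrderDual.ofDual_toDual] at h2
      rw [h2, mul_zero]
  · change toMatrix (s * g) (OrderDual.ofDual (ofLex x).2) (ofLex x).1 <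
      toMatrix (s * h) (OrderDual.ofDual (ofLex x).2) (ofLex x).1
    rw [← sub_pos, hentry, Finset.sum_eq_single (OrderDual.ofDual (ofLex x).2)]
    · rw [(isUnitriangular s).2, one_mul, sub_pos]
      exact hlt
    · intro c _ hne
      rcases lt_or_gt_of_ne hne with hc | hc
      · rw [(isUnitriangular s).1 _ _ hc, zero_mul]
      · have h1 : toLex ((ofLex x).1, OrderDual.toDual c) < x := by
          rw [Prod.Lex.lt_iff]
          exact Or.inr ⟨rfl, hc⟩
        have h2 := hvanish _ h1
        simp only [ofLex_toLex, OrderDual.ofDual_toDual] at h2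
        rw [h2, mul_zero]
    · simp

instance twoUniqueProds : TwoUniqueProds (unitriangular k) :=
  letI : LinearOrder (unitriangular k) := LinearOrder.lift' lexKey lexKey_injective
  haveI : MulLeftStrictMono (unitriangular k) := ⟨fun s _ _ h => lexKey_mul_lt s h⟩
  inferInstance

theorem noZeroDivisors_groupRing : NoZeroDivisors (MonoidAlgebra ℤ (unitriangular k)) :=
  inferInstance

theorem exists_toMatrix_pow_eq (p : ℕ) [hp : Fact p.Prime] (g : unitriangular k) (j : ℕ) :
    ∃ (m : ℕ) (r : Matrix (Fin k) (Fin k) ℤ), toMatrix g ^ p ^ m = 1 + (p : ℤ) ^ (j + 1) • r := by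
  induction j with
  | zero =>
    have hnil : (toMatrix g - 1) ^ k = 0 := by
      have hc : (toMatrix g).charpoly = (Polynomial.X - 1) ^ k := by
        rw [Matrix.charpoly_of_isUpperTriangular _ (fun a b hab => (isUnitriangular g).1 a b hab)]
        simp [(isUnitriangular g).2]
      have h := Matrix.aeval_self_charpoly (toMatrix g)
      rw [hc] at h
      simpa using h
    obtain ⟨r, hr⟩ := (Commute.one_left (toMatrix g - 1)).exists_add_pow_prime_pow_eq hp.out k
    have hk : k ≤ p ^ k := (Nat.lt_pow_self hp.out.one_lt).le
    refine ⟨k, (toMatrix g - 1) * r, ?_⟩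
    rw [add_sub_cancel, one_pow, pow_eq_zero_of_le hk hnil, add_zero] at hr
    rw [hr, zero_add, pow_one, mul_one, mul_assoc, zsmul_eq_mul, Int.cast_natCast]
  | succ j ih =>
    obtain ⟨m, r, hr⟩ := ih
    obtain ⟨t, ht⟩ :=
      (Commute.one_left ((p : ℤ) ^ (j + 1) • r)).exists_add_pow_prime_eq hp.out
    obtain ⟨q, hq⟩ : ∃ q, (j + 1) * p = j + 1 + 1 + q :=
      Nat.exists_eq_add_of_le (by nlinarith [hp.out.two_le])
    refine ⟨m + 1, (p : ℤ) ^ q • r ^ p + r * t, ?_⟩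
    rw [pow_succ, pow_mul, hr, ht, one_pow, smul_pow, ← pow_mul, hq, smul_add, smul_smul,
      ← pow_add, mul_one, pow_succ (p : ℤ) (j + 1), ← smul_smul ((p : ℤ) ^ (j + 1)), add_assoc]
    congr 2
    rw [mul_smul_comm, smul_mul_assoc, mul_assoc, zsmul_eq_mul (r * t) (p : ℤ), Int.cast_natCast]

/-- Reduction modulo `m` of unitriangular matrices. -/
def mapZMod (k m : ℕ) : unitriangular k →* (Matrix (Fin k) (Fin k) (ZMod m))ˣ :=
  (Units.map
    ((Int.castRingHom (ZMod m)).mapMatrix : Matrix (Fin k) (Fin k) ℤ →+* _).toMonoidHom).comp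
    (unitriangular k).subtype

theorem coe_mapZMod (m : ℕ) (g : unitriangular k) (a b : Fin k) :
    (mapZMod k m g).1 a b = (toMatrix g a b : ZMod m) := rfl

theorem isResiduallyPGroup (p : ℕ) [hp : Fact p.Prime] :
    IsResiduallyPGroup p (unitriangular k) := by
  intro T
  obtain ⟨B, hB⟩ : ∃ B : ℕ, ∀ g ∈ T, ∀ a b, (toMatrix g a b).natAbs ≤ B :=
    ⟨∑ g ∈ T, ∑ a, ∑ b, (toMatrix g a b).natAbs, fun g hg a b => by
      refine le_trans ?_ (Finset.single_le_sum (f := fun g => ∑ a, ∑ b, (toMatrix g a b).natAbs)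
        (fun _ _ => Nat.zero_le _) hg)
      refine le_trans ?_ (Finset.single_le_sum (f := fun a => ∑ b, (toMatrix g a b).natAbs)
        (fun _ _ => Nat.zero_le _) (Finset.mem_univ a))
      exact Finset.single_le_sum (f := fun b => (toMatrix g a b).natAbs)
        (fun _ _ => Nat.zero_le _) (Finset.mem_univ b)⟩
  have hpe : 2 * B < p ^ (2 * B) := Nat.lt_pow_self hp.out.one_lt
  refine ⟨(mapZMod k (p ^ (2 * B))).range, inferInstance, ?_,
    (mapZMod k (p ^ (2 * B))).rangeRestrict,
    ?_, ?_⟩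
  · have : NeZero (p ^ (2 * B)) := ⟨(by omega)⟩
    infer_instance
  · rintro ⟨_, g, rfl⟩
    obtain ⟨m, r, hr⟩ := exists_toMatrix_pow_eq p g (2 * B)
    refine ⟨m, Subtype.ext ?_⟩
    change mapZMod k (p ^ (2 * B)) g ^ p ^ m = 1
    rw [← map_pow]
    refine Units.ext (Matrix.ext fun a b => ?_)
    rw [coe_mapZMod, map_pow, hr, Matrix.add_apply, Matrix.smul_apply, pow_succ]
    have h0 : ((p : ZMod (p ^ (2 * B))) ^ (2 * B)) = 0 := by
      rw [← Nat.cast_pow, ZMod.natCast_self]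
    push_cast
    simp [h0, Matrix.one_apply]
  · intro g hg h hh hgh
    refine toMatrix_injective (Matrix.ext fun a b => ?_)
    have h1 : (toMatrix g a b : ZMod (p ^ (2 * B))) = (toMatrix h a b : ZMod (p ^ (2 * B))) := by
      rw [← coe_mapZMod, ← coe_mapZMod]
      exact congrArg (fun u => u.1.1 a b) hgh
    rw [ZMod.intCast_eq_intCast_iff_dvd_sub] at h1
    have h2 := hB g hg a b
    have h3 := hB h hh a b
    have h4 := Int.eq_zero_of_abs_lt_dvd h1 (by
      have hpe' : (2 * B : ℤ) < (p : ℤ) ^ (2 * B) := by exact_mod_cast hpe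
      rw [abs_lt]
      push_cast
      omega)
    omega

end unitriangular

end Unitriangular

section Folner

open scoped Pointwise

/-- A polynomially bounded sequence does not grow exponentially. -/
theorem exists_mul_succ_le_of_le_pow (f : ℕ → ℕ) (hf : 0 < f 0) (A D N : ℕ)
    (hA : ∀ i, f i ≤ A * (i + 1) ^ D) :
    ∃ i, 2 * N * f (i + 1) ≤ (2 * N + 1) * f i := by
  by_contra! hcon
  rcases Nat.eq_zero_or_pos N with rfl | hN
  · have := hcon 0; simp at this
  set x : ℝ := (2 * N + 1) / (2 * N) with hx
  have hN' : (0 : ℝ) < 2 * N := by positivity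
  have hx1 : 1 < x := by rw [hx, one_lt_div hN']; linarith
  have hgrow : ∀ i, x ^ i ≤ f i := by
    intro i
    induction i with
    | zero => simpa using Nat.one_le_iff_ne_zero.mpr hf.ne'
    | succ i ih =>
      have h : ((2 * N + 1) * f i : ℝ) < 2 * N * f (i + 1) := by exact_mod_cast hcon i
      calc x ^ (i + 1) = x ^ i * x := pow_succ _ _
        _ ≤ f i * x := mul_le_mul_of_nonneg_right ih (by positivity)
        _ = (2 * N + 1) * f i / (2 * N) := by rw [hx]; ring
        _ ≤ f (i + 1) := by rw [div_le_iff₀ hN']; linarith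
  have hlim := (tendsto_pow_const_div_const_pow_of_one_lt D hx1).comp
    (Filter.tendsto_add_atTop_nat 1)
  have hev := hlim.eventually (gt_mem_nhds (show (0 : ℝ) < 1 / (x * (A + 1)) by positivity))
  obtain ⟨i, hi⟩ := hev.exists
  simp only [Function.comp_apply] at hi
  have hA' : (f i : ℝ) ≤ A * ((i + 1 : ℕ) : ℝ) ^ D := by exact_mod_cast hA i
  rw [div_lt_div_iff₀ (by positivity) (by positivity), one_mul, pow_succ] at hi
  have h1 := hgrow i
  have h2 : x * ((A + 1) * ((i + 1 : ℕ) : ℝ) ^ D) < x * x ^ i := by linarith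
  have h3 := lt_of_mul_lt_mul_left h2 (by positivity)
  have h4 : (0 : ℝ) ≤ ((i + 1 : ℕ) : ℝ) ^ D := by positivity
  linarith

namespace unitriangular

variable {k : ℕ}

/-- The elements of the unitriangular group whose entries are bounded by `R ^ (b - a)`. -/
def box (k R : ℕ) : Set (unitriangular k) :=
  {g | ∀ a b, |toMatrix g a b| ≤ (R : ℤ) ^ ((b : ℕ) - (a : ℕ))}

theorem box_finite_and_ncard_le (k : ℕ) {R : ℕ} (hR : 1 ≤ R) :
    (box k R).Finite ∧ (box k R).ncard ≤ (2 * R ^ k + 1) ^ (k * k) := by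
  have hle : ∀ a b : Fin k, (R : ℤ) ^ ((b : ℕ) - (a : ℕ)) ≤ R ^ k := fun a b =>
    pow_le_pow_right₀ (by exact_mod_cast hR) (by omega)
  let φ : box k R → (Fin k × Fin k → Finset.Icc (-(R ^ k : ℤ)) (R ^ k)) := fun g x =>
    ⟨toMatrix g.1 x.1 x.2, Finset.mem_Icc.mpr (abs_le.mp ((g.2 x.1 x.2).trans (hle _ _)))⟩
  have hφ : Function.Injective φ := fun g h hgh =>
    Subtype.ext <| toMatrix_injective <| Matrix.ext fun a b =>
      congrArg Subtype.val (congrFun hgh (a, b))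
  have hfin : Finite (box k R) := Finite.of_injective φ hφ
  refine ⟨Set.toFinite _, ?_⟩
  have h := Nat.card_le_card_of_injective φ hφ
  rw [Nat.card_coe_set_eq] at h
  refine h.trans (le_of_eq ?_)
  rw [Nat.card_eq_fintype_card]
  simp only [Fintype.card_fun, Fintype.card_coe, Fintype.card_prod, Fintype.card_fin, Int.card_Icc]
  congr 1
  rw [show (R ^ k : ℤ) + 1 - -(R ^ k) = ((2 * R ^ k + 1 : ℕ) : ℤ) by push_cast; ring,
    Int.toNat_natCast]

theorem mul_mem_box {R σ : ℕ} (hR : 1 ≤ R) {g s : unitriangular k} (hg : g ∈ box k R)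
    (hs : ∀ a b, |toMatrix s a b| ≤ σ) : g * s ∈ box k (R + k * σ) := by
  intro a b
  rw [map_mul, Matrix.mul_apply]
  rcases lt_trichotomy a b with hab | rfl | hab
  · obtain ⟨d, hd⟩ : ∃ d, (b : ℕ) - (a : ℕ) = d + 1 :=
      ⟨(b : ℕ) - (a : ℕ) - 1, by have : (a : ℕ) < b := hab; omega⟩
    have hterm : ∀ c, c ≠ b → |toMatrix g a c * toMatrix s c b| ≤ (R : ℤ) ^ d * σ := by
      intro c hc
      rcases lt_or_gt_of_ne hc with h | h
      · rw [abs_mul]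
        refine mul_le_mul ((hg a c).trans (pow_le_pow_right₀ (by exact_mod_cast hR) ?_)) (hs c b)
          (abs_nonneg _) (by positivity)
        have : (c : ℕ) < b := h
        omega
      · rw [(isUnitriangular s).1 c b h, mul_zero, abs_zero]
        positivity
    rw [hd, ← Finset.add_sum_erase _ _ (Finset.mem_univ b), (isUnitriangular s).2, mul_one]
    calc |toMatrix g a b + ∑ c ∈ Finset.univ.erase b, toMatrix g a c * toMatrix s c b|
        ≤ |toMatrix g a b| + |∑ c ∈ Finset.univ.erase b, toMatrix g a c * toMatrix s c b| :=
          abs_add_le _ _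
      _ ≤ (R : ℤ) ^ (d + 1) + ∑ c ∈ Finset.univ.erase b, (R : ℤ) ^ d * σ := by
        gcongr
        · exact hd ▸ hg a b
        · exact (Finset.abs_sum_le_sum_abs _ _).trans
            (Finset.sum_le_sum fun c hc => hterm c (Finset.ne_of_mem_erase hc))
      _ ≤ (R : ℤ) ^ (d + 1) + ∑ c : Fin k, (R : ℤ) ^ d * σ := by
        gcongr
        exact Finset.erase_subset _ _
      _ = (R : ℤ) ^ d * (R + k * σ) := by simp; ring
      _ ≤ ((R : ℤ) + k * σ) ^ d * (R + k * σ) := by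
        gcongr
        exact le_add_of_nonneg_right (by positivity)
      _ = ((R + k * σ : ℕ) : ℤ) ^ (d + 1) := by push_cast; ring
  · rw [← Matrix.mul_apply, ← map_mul, (isUnitriangular (g * s)).2]
    simp
  · rw [← Matrix.mul_apply, ← map_mul, (isUnitriangular (g * s)).1 _ _ hab, abs_zero]
    positivity

/-- Unitriangular groups are amenable: Følner's condition. -/
theorem exists_folner [DecidableEq (unitriangular k)] (S : Finset (unitriangular k)) (N : ℕ) :
    ∃ B : Finset (unitriangular k), B.Nonempty ∧
      2 * N * (B * S).card ≤ (2 * N + 1) * B.card := by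
  obtain ⟨σ, hσ⟩ : ∃ σ : ℕ, ∀ g ∈ S, ∀ a b, |toMatrix g a b| ≤ σ :=
    ⟨∑ g ∈ S, ∑ a, ∑ b, (toMatrix g a b).natAbs, fun g hg a b => by
      rw [Int.abs_eq_natAbs]
      norm_cast
      refine le_trans ?_ (Finset.single_le_sum (f := fun g => ∑ a, ∑ b, (toMatrix g a b).natAbs)
        (fun _ _ => Nat.zero_le _) hg)
      refine le_trans ?_ (Finset.single_le_sum (f := fun a => ∑ b, (toMatrix g a b).natAbs)
        (fun _ _ => Nat.zero_le _) (Finset.mem_univ a))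
      exact Finset.single_le_sum (f := fun b => (toMatrix g a b).natAbs)
        (fun _ _ => Nat.zero_le _) (Finset.mem_univ b)⟩
  let R : ℕ → ℕ := fun i => 1 + i * (k * σ)
  have hR1 : ∀ i, 1 ≤ R i := fun i => Nat.le_add_right _ _
  have hfin : ∀ i, (box k (R i)).Finite := fun i => (box_finite_and_ncard_le k (hR1 i)).1
  have hone : ∀ i, (1 : unitriangular k) ∈ box k (R i) := fun i a b => by
    rw [map_one, Matrix.one_apply]
    split_ifs
    · exact one_le_pow₀ (a := (R i : ℤ)) (by exact_mod_cast hR1 i)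
    · simp
  obtain ⟨i, hi⟩ := exists_mul_succ_le_of_le_pow (fun i => (hfin i).toFinset.card)
    (Finset.card_pos.mpr ⟨1, by simpa using hone 0⟩)
    ((3 * (1 + k * σ) ^ k) ^ (k * k)) (k * (k * k)) N (fun i => by
      rw [← Set.ncard_eq_toFinset_card _ (hfin i), pow_mul (i + 1) k, ← mul_pow]
      refine (box_finite_and_ncard_le k (hR1 i)).2.trans (Nat.pow_le_pow_left ?_ _)
      have h1 : R i ≤ (1 + k * σ) * (i + 1) := by
        simp only [R]; nlinarith [Nat.zero_le (k * σ)]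
      have h2 : R i ^ k ≤ (1 + k * σ) ^ k * (i + 1) ^ k := by
        rw [← mul_pow]; exact Nat.pow_le_pow_left h1 _
      have h3 : 1 ≤ R i ^ k := Nat.one_le_pow _ _ (hR1 i)
      nlinarith)
  refine ⟨(hfin i).toFinset, ⟨1, by simpa using hone i⟩, le_trans ?_ hi⟩
  refine Nat.mul_le_mul_left _ (Finset.card_le_card ?_)
  intro x hx
  obtain ⟨g, hg, s, hs, rfl⟩ := Finset.mem_mul.mp hx
  rw [Set.Finite.mem_toFinset] at hg ⊢
  have h := mul_mem_box (hR1 i) hg (hσ s hs)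
  have hRs : R i + k * σ = R (i + 1) := by simp only [R]; ring
  rwa [hRs] at h

end unitriangular

end Folner

namespace unitriangular

variable {k : ℕ}

/-- A homomorphism to matrices with unitriangular values lifts to the unitriangular group. -/
noncomputable def ofMatrixHom {H : Type*} [Group H] (f : H →* Matrix (Fin k) (Fin k) ℤ)
    (hf : ∀ h, IsUnitriangular (f h)) : H →* unitriangular k :=
  f.toHomUnits.codRestrict (unitriangular k) fun h => ⟨hf h, by
    rw [← map_inv]; exact hf h⁻¹⟩

/-- The upper left block of a unitriangular matrix, without the last row and column. -/
noncomputable def block (k : ℕ) : unitriangular (k + 1) →* unitriangular k :=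
  ofMatrixHom
    { toFun := fun g => (toMatrix g).submatrix Fin.castSucc Fin.castSucc
      map_one' := by
        rw [map_one, Matrix.submatrix_one _ (Fin.castSucc_injective k)]
      map_mul' := fun g h => by
        ext a b
        simp only [map_mul, Matrix.submatrix_apply, Matrix.mul_apply, Fin.sum_univ_castSucc]
        rw [(isUnitriangular h).1 (Fin.last k) _ (Fin.castSucc_lt_last b), mul_zero, add_zero] }
    fun g => ⟨fun a b hab => (isUnitriangular g).1 _ _ hab, fun a => (isUnitriangular g).2 _⟩

theorem toMatrix_block (g : unitriangular (k + 1)) (a b : Fin k) :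
    toMatrix (block k g) a b = toMatrix g a.castSucc b.castSucc := rfl

theorem eq_one_of_block_eq_one {g : unitriangular (k + 1)} (hg : block k g = 1)
    (h : ∀ a : Fin k, toMatrix g a.castSucc (Fin.last k) = 0) : g = 1 := by
  refine toMatrix_injective (Matrix.ext fun a b => ?_)
  rw [map_one]
  rcases lt_trichotomy a b with hab | rfl | hab
  · rw [Matrix.one_apply_ne hab.ne]
    obtain ⟨a, rfl⟩ := Fin.exists_castSucc_eq.mpr (hab.trans_le (Fin.le_last b)).ne
    rcases Fin.eq_castSucc_or_eq_last b with ⟨b, rfl⟩ | rfl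
    · rw [← toMatrix_block, hg, map_one, Matrix.one_apply_ne]
      rintro rfl
      exact hab.ne rfl
    · exact h a
  · rw [(isUnitriangular g).2, Matrix.one_apply_eq]
  · rw [(isUnitriangular g).1 _ _ hab, Matrix.one_apply_ne hab.ne']

end unitriangular

theorem FreeGroup.exists_syllables {α : Type*} (c : FreeGroup α) :
    ∃ l : List (α × ℤ), (∀ x ∈ l, x.2 ≠ 0) ∧ l.IsChain (fun x y => x.1 ≠ y.1) ∧
      c = (l.map fun x => FreeGroup.of x.1 ^ x.2).prod := by
  classical
  have step : ∀ (l : List (α × ℤ)), (∀ x ∈ l, x.2 ≠ 0) → l.IsChain (fun x y => x.1 ≠ y.1) →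
      ∀ (a : α) (e : ℤ), e ≠ 0 → ∃ l' : List (α × ℤ), (∀ x ∈ l', x.2 ≠ 0) ∧
        l'.IsChain (fun x y => x.1 ≠ y.1) ∧
        FreeGroup.of a ^ e * (l.map fun x => FreeGroup.of x.1 ^ x.2).prod =
          (l'.map fun x => FreeGroup.of x.1 ^ x.2).prod := by
    intro l hl hc a e he
    match l with
    | [] => exact ⟨[(a, e)], by simpa using he, by simp, by simp⟩
    | (a', e') :: t =>
      by_cases haa : a = a'
      · subst haa
        by_cases hee : e + e' = 0
        · refine ⟨t, fun x hx => hl x (List.mem_cons_of_mem _ hx), hc.tail, ?_⟩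
          rw [List.map_cons, List.prod_cons, ← mul_assoc, ← zpow_add, hee, zpow_zero, one_mul]
        · refine ⟨(a, e + e') :: t, ?_, ?_, ?_⟩
          · intro x hx
            rcases List.mem_cons.mp hx with rfl | hx
            · exact hee
            · exact hl x (List.mem_cons_of_mem _ hx)
          · rw [List.isChain_cons] at hc ⊢
            exact hc
          · simp [← mul_assoc, zpow_add]
      · refine ⟨(a, e) :: (a', e') :: t, ?_, List.IsChain.cons_cons haa hc, by simp⟩
        intro x hx
        rcases List.mem_cons.mp hx with rfl | hx
        · exact he
        · exact hl x hx
  have key : ∀ L : List (α × Bool), ∃ l : List (α × ℤ), (∀ x ∈ l, x.2 ≠ 0) ∧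
      l.IsChain (fun x y => x.1 ≠ y.1) ∧
      FreeGroup.mk L = (l.map fun x => FreeGroup.of x.1 ^ x.2).prod := by
    intro L
    induction L with
    | nil => exact ⟨[], by simp, by simp, by simp [FreeGroup.one_eq_mk]⟩
    | cons x L ih =>
      obtain ⟨l, h1, h2, h3⟩ := ih
      obtain ⟨a, s⟩ := x
      obtain ⟨l', h1', h2', h3'⟩ := step l h1 h2 a (if s then 1 else -1) (by split_ifs <;> simp)
      refine ⟨l', h1', h2', ?_⟩
      rw [← h3', ← h3]
      cases s
      · simp [FreeGroup.of, FreeGroup.invRev]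
      · simp [FreeGroup.of]
  have h := key c.toWord
  rwa [FreeGroup.mk_toWord] at h

section Syllables

variable {α : Type*} [DecidableEq α]

/-- The matrix with ones at the positions `(s, s + 1)` such that `s` is the position of a syllable
of letter `i`. -/
def syllableMatrix (l : List (α × ℤ)) (i : α) :
    Matrix (Fin (l.length + 1)) (Fin (l.length + 1)) ℤ :=
  fun a b => if (b : ℕ) = a + 1 ∧ (l[(a : ℕ)]?).map Prod.fst = some i then 1 else 0

theorem syllableMatrix_mul_self {l : List (α × ℤ)} (hl : l.IsChain (fun x y => x.1 ≠ y.1))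
    (i : α) : syllableMatrix l i * syllableMatrix l i = 0 := by
  ext a b
  rw [Matrix.mul_apply]
  refine Finset.sum_eq_zero fun c _ => ?_
  by_contra hne
  have h1 := left_ne_zero_of_mul hne
  have h2 := right_ne_zero_of_mul hne
  simp only [syllableMatrix, ne_eq, ite_eq_right_iff, one_ne_zero, imp_false, not_not] at h1 h2
  obtain ⟨hc, ha⟩ := h1
  obtain ⟨hb, hc'⟩ := h2
  have hbl := b.2
  rw [hc] at hc' hb
  have hlen : (a : ℕ) + 1 < l.length := by omega
  have := List.isChain_iff_getElem.mp hl a hlen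
  rw [List.getElem?_eq_getElem (by omega)] at ha hc'
  simp only [Option.map_some, Option.some.injEq] at ha hc'
  exact this (ha.trans hc'.symm)

/-- The representation of the infinite cyclic group attached to `syllableMatrix`. -/
noncomputable def syllableHom {l : List (α × ℤ)} (hl : l.IsChain (fun x y => x.1 ≠ y.1)) (i : α) :
    Multiplicative ℤ →* unitriangular (l.length + 1) :=
  unitriangular.ofMatrixHom
    { toFun := fun e => 1 + e.toAdd • syllableMatrix l i
      map_one' := by simp
      map_mul' := fun e e' => by
        simp only [add_mul, mul_add, one_mul, mul_one, smul_mul_smul_comm,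
          syllableMatrix_mul_self hl, smul_zero, add_zero, toAdd_mul, add_smul]
        abel }
    fun e => ⟨fun a b hab => by
        have : (b : ℕ) < a := hab
        simp [-zsmul_eq_mul, Matrix.one_apply_ne hab.ne', syllableMatrix,
          show ¬ ((b : ℕ) = a + 1) by omega],
      fun a => by simp [-zsmul_eq_mul, syllableMatrix]⟩

theorem toMatrix_syllableHom {l : List (α × ℤ)} (hl : l.IsChain (fun x y => x.1 ≠ y.1)) (i : α)
    (e : ℤ) : unitriangular.toMatrix (syllableHom hl i (Multiplicative.ofAdd e)) =
      1 + e • syllableMatrix l i := rfl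

theorem exists_unitriangular_map_ne_one {c : FreeGroup α} (hc : c ≠ 1) :
    ∃ (h : ℕ) (ρ : FreeGroup α →* unitriangular h), ρ c ≠ 1 := by
  obtain ⟨l, hl0, hl, rfl⟩ := FreeGroup.exists_syllables c
  let ρ : FreeGroup α →* unitriangular (l.length + 1) :=
    FreeGroup.lift fun i => syllableHom hl i (Multiplicative.ofAdd 1)
  have hρ : ∀ (i : α) (e : ℤ), unitriangular.toMatrix (ρ (FreeGroup.of i ^ e)) =
      1 + e • syllableMatrix l i := fun i e => by
    rw [map_zpow, FreeGroup.lift_apply_of, ← map_zpow, ← ofAdd_zsmul, smul_eq_mul, mul_one,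
      toMatrix_syllableHom]
  have key : ∀ m s, s + m = l.length → ∀ a : Fin (l.length + 1),
      ((a : ℕ) < s → unitriangular.toMatrix
        (ρ ((l.drop s).map fun x => FreeGroup.of x.1 ^ x.2).prod) a (Fin.last _) = 0) ∧
      ((a : ℕ) = s → unitriangular.toMatrix
        (ρ ((l.drop s).map fun x => FreeGroup.of x.1 ^ x.2).prod) a (Fin.last _) ≠ 0) := by
    intro m
    induction m with
    | zero =>
      intro s hs a
      obtain rfl : s = l.length := hs
      simp only [List.drop_length, List.map_nil, List.prod_nil, map_one]
      refine ⟨fun h => Matrix.one_apply_ne ?_, fun h => ?_⟩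
      · rintro rfl; simp at h
      · obtain rfl : a = Fin.last _ := Fin.ext h
        simp
    | succ m ih =>
      intro s hs a
      have hsl : s < l.length := by omega
      rw [List.drop_eq_getElem_cons hsl, List.map_cons, List.prod_cons, map_mul, map_mul, hρ]
      set P := unitriangular.toMatrix
        (ρ ((l.drop (s + 1)).map fun x => FreeGroup.of x.1 ^ x.2).prod) with hP
      have hP0 : ∀ a : Fin (l.length + 1), ((a : ℕ) < s + 1 → P a (Fin.last _) = 0) ∧
          ((a : ℕ) = s + 1 → P a (Fin.last _) ≠ 0) := ih (s + 1) (by omega)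
      rw [add_mul, one_mul, Matrix.add_apply, smul_mul_assoc, Matrix.smul_apply, Matrix.mul_apply]
      have hsum : ∀ h : (a : ℕ) < l.length,
          ∑ b, syllableMatrix l l[s].1 a b * P b (Fin.last _) =
            (if (l[(a : ℕ)]?).map Prod.fst = some l[s].1 then 1 else 0) *
              P ⟨a + 1, by omega⟩ (Fin.last _) := fun h => by
        rw [Finset.sum_eq_single ⟨a + 1, by omega⟩]
        · simp only [syllableMatrix, true_and]
        · intro b _ hb
          have : ¬ ((b : ℕ) = a + 1) := fun h' => hb (Fin.ext h')
          simp [syllableMatrix, this]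
        · simp
      constructor
      · intro h
        rw [hsum (by omega), (hP0 a).1 (by omega), (hP0 ⟨a + 1, by omega⟩).1 (by simpa using h)]
        simp
      · intro h
        rw [hsum (by omega), (hP0 a).1 (by omega),
          if_pos (by rw [h, List.getElem?_eq_getElem hsl, Option.map_some]), one_mul, zero_add]
        exact mul_ne_zero (hl0 _ (List.getElem_mem _))
          ((hP0 ⟨a + 1, by omega⟩).2 (congrArg (· + 1) h))
  refine ⟨_, ρ, fun h => ?_⟩
  have h0 := (key l.length 0 (by simp) 0).2 rfl
  rw [List.drop_zero, h, map_one] at h0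
  apply hc
  by_cases hn : l.length = 0
  · simp [List.length_eq_zero_iff.mp hn]
  · refine absurd (Matrix.one_apply_ne fun h' => hn ?_) h0
    have := congrArg Fin.val h'
    simpa using this.symm

/-- For every nontrivial element `c` of a free group there are a unitriangular representation
killing `c` and a derivation with values in its group ring not killing `c`. -/
theorem exists_unitriangular_isCrossedHom [Fintype α] {c : FreeGroup α} (hc : c ≠ 1) :
    ∃ (k : ℕ) (ρ : FreeGroup α →* unitriangular k)
      (d : FreeGroup α → MonoidAlgebra ℤ (unitriangular k)),
      ρ c = 1 ∧ IsCrossedHom ((MonoidAlgebra.of ℤ _).comp ρ) d ∧ d c ≠ 0 := by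
  classical
  have hex := exists_unitriangular_map_ne_one hc
  obtain ⟨k, hk⟩ : ∃ k, Nat.find hex = k + 1 := by
    refine Nat.exists_eq_succ_of_ne_zero fun h0 => ?_
    obtain ⟨ρ, hρ⟩ := Nat.find_spec hex
    have hsub : Subsingleton (unitriangular (Nat.find hex)) := by
      rw [h0]
      exact unitriangular.toMatrix_injective.subsingleton
    exact hρ (Subsingleton.elim _ _)
  have hspec := Nat.find_spec hex
  have hmin := fun m => Nat.find_min hex (m := m)
  rw [hk] at hspec hmin
  obtain ⟨ρ, hρ⟩ := hspec
  have hblock : unitriangular.block k (ρ c) = 1 := by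
    by_contra h
    exact hmin k (Nat.lt_succ_self k) ⟨(unitriangular.block k).comp ρ, h⟩
  let f : FreeGroup α →* Matrix (Fin k) (Fin k) ℤ :=
    unitriangular.toMatrix.comp ((unitriangular.block k).comp ρ)
  let D : FreeGroup α → Matrix (Fin k) (Fin k) ℤ := fun g => Matrix.of fun a _ =>
    unitriangular.toMatrix (ρ g) a.castSucc (Fin.last k)
  have hD : IsCrossedHom f D := fun g h => by
    ext a b
    simp only [D, f, map_mul, Matrix.mul_apply, Fin.sum_univ_castSucc, Matrix.add_apply,
      smul_eq_mul, MonoidHom.comp_apply, unitriangular.toMatrix_block, Matrix.of_apply]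
    rw [(unitriangular.isUnitriangular (ρ h)).2, mul_one, add_comm]
  have hDc : D c ≠ 0 := fun h0 => hρ <| unitriangular.eq_one_of_block_eq_one hblock fun a =>
    congrFun (congrFun h0 a) a
  rw [hD.eq_sum_foxDeriv] at hDc
  obtain ⟨i, -, hi⟩ := Finset.exists_ne_zero_of_sum_ne_zero hDc
  have hi' := left_ne_zero_of_smul hi
  let ρ' := (unitriangular.block k).comp ρ
  refine ⟨k, ρ', fun g => groupRingMap ρ' (foxDeriv g i), hblock, fun g h => ?_, fun h0 => hi' ?_⟩
  · simp [isCrossedHom_foxDeriv g h, groupRingMap]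
  · have h1 := lift_groupRingMap unitriangular.toMatrix ρ' (foxDeriv c i)
    rw [show groupRingMap ρ' (foxDeriv c i) = 0 from h0, map_zero] at h1
    exact h1.symm

end Syllables

theorem FreeGroup.subsingleton_of_isMulCommutative {α : Type*} [IsMulCommutative (FreeGroup α)] :
    Subsingleton α := by
  classical
  refine ⟨fun i j => by_contra fun hij => ?_⟩
  have h := congrArg (FreeGroup.lift fun a : α => if a = i then Equiv.swap (0 : Fin 3) 1 else
    Equiv.swap 1 2) (mul_comm' (FreeGroup.of i) (FreeGroup.of j))
  simp only [_root_.map_mul, FreeGroup.lift_apply_of, if_true, if_neg (Ne.symm hij)] at h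
  revert h
  decide

theorem FreeGroup.isCyclic_of_isMulCommutative {α : Type*} (H : Subgroup (FreeGroup α))
    [IsMulCommutative H] : IsCyclic H := by
  let e := IsFreeGroup.toFreeGroup H
  have : IsMulCommutative (FreeGroup (IsFreeGroup.Generators H)) :=
    ⟨⟨fun a b => e.symm.injective (by rw [_root_.map_mul, _root_.map_mul, mul_comm'])⟩⟩
  have := FreeGroup.subsingleton_of_isMulCommutative (α := IsFreeGroup.Generators H)
  rcases isEmpty_or_nonempty (IsFreeGroup.Generators H) with h | ⟨⟨x⟩⟩
  · exact isCyclic_of_surjective e.symm e.symm.surjective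
  · have : Unique (IsFreeGroup.Generators H) := uniqueOfSubsingleton x
    exact isCyclic_of_surjective e.symm e.symm.surjective

theorem Submodule.exists_linearIndependent_of_free {R M : Type*} [CommRing R] [Nontrivial R]
    [AddCommGroup M] [Module R M] (K : Submodule R M) [Module.Free R K] [Module.Finite R K] :
    ∃ v : Fin (Module.finrank R K) → M, (∀ l, v l ∈ K) ∧ LinearIndependent R v := by
  have b := Module.finBasis R K
  exact ⟨K.subtype ∘ b, fun l => (b l).2, b.linearIndependent.map' K.subtype K.ker_subtype⟩

theorem LinearMap.finrank_ker_add_finrank_of_surjective {R M N : Type*} [CommRing R] [IsDomain R]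
    [AddCommGroup M] [AddCommGroup N] [Module R M] [Module R N] [Module.Finite R M]
    (q : M →ₗ[R] N) (hq : Function.Surjective q) :
    Module.finrank R (LinearMap.ker q) + Module.finrank R N = Module.finrank R M := by
  rw [← (q.quotKerEquivOfSurjective hq).finrank_eq, add_comm,
    Submodule.finrank_quotient_add_finrank]

section Relators

variable {α : Type*} [Fintype α] [DecidableEq α]

theorem exponentSum_surjective : Function.Surjective (exponentSum (α := α)) := fun v => by
  refine ⟨(Finset.univ.toList.map fun i => FreeGroup.of i ^ v.toAdd i).prod, ?_⟩
  rw [map_list_prod, List.map_map, Finset.prod_map_toList]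
  apply Multiplicative.toAdd.injective
  rw [toAdd_prod]
  ext j
  simp [exponentSum, Finset.sum_apply, Pi.single_apply]

theorem firstBetti_eq_finrank (G : Type*) [Group G] :
    firstBetti G = Module.finrank ℤ (Additive (Abelianization G)) := by
  rw [firstBetti, (TensorProduct.isBaseChange ℤ (Additive (Abelianization G)) ℚ).finrank_eq]

theorem exists_relators {G : Type*} [Group G] (π : FreeGroup α →* G) (hπ : Function.Surjective π) :
    ∃ (h : ℕ) (w : Fin h → FreeGroup α), h + firstBetti G = Fintype.card α ∧ (∀ l, π (w l) = 1) ∧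
      LinearIndependent ℤ fun l => (exponentSum (w l)).toAdd := by
  obtain ⟨q, hq⟩ : ∃ q : (α → ℤ) →ₗ[ℤ] Additive (Abelianization G),
      ∀ u, q (exponentSum u).toAdd = Additive.ofMul (Abelianization.of (π u)) := by
    let q : (α → ℤ) →ₗ[ℤ] Additive (Abelianization G) :=
      Fintype.linearCombination ℤ fun i => Additive.ofMul (Abelianization.of (π (FreeGroup.of i)))
    have : q.toAddMonoidHom.toMultiplicativeLeft.comp exponentSum = Abelianization.of.comp π :=
      FreeGroup.ext_hom _ _ fun i => by
        simp [exponentSum, q, Fintype.linearCombination_apply_single]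
    exact ⟨q, fun u => congrArg Additive.ofMul (DFunLike.congr_fun this u)⟩
  have hqs : Function.Surjective q := fun x => by
    obtain ⟨g, hg⟩ := QuotientGroup.mk'_surjective _ x.toMul
    obtain ⟨u, rfl⟩ := hπ g
    exact ⟨(exponentSum u).toAdd, (hq u).trans hg⟩
  have hcomm : commutator G = (commutator (FreeGroup α)).map π := by
    rw [commutator_def, commutator_def, Subgroup.map_commutator,
      Subgroup.map_top_of_surjective π hπ]
  have hlift : ∀ v ∈ LinearMap.ker q, ∃ w, π w = 1 ∧ (exponentSum w).toAdd = v := fun v hv => by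
    obtain ⟨u, hu⟩ := exponentSum_surjective (Multiplicative.ofAdd v)
    have hv : π u ∈ commutator G := by
      rw [← Abelianization.ker_of, MonoidHom.mem_ker]
      apply Additive.ofMul.injective
      rw [← hq, hu]
      exact hv
    rw [hcomm] at hv
    obtain ⟨u', hu', h⟩ := hv
    refine ⟨u * u'⁻¹, by simp [h], ?_⟩
    have : exponentSum u' = 1 := Abelianization.commutator_subset_ker exponentSum hu'
    simp [this, hu]
  obtain ⟨v, hv, hli⟩ := (LinearMap.ker q).exists_linearIndependent_of_free
  choose w hw hw' using fun l => hlift (v l) (hv l)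
  have hcard := q.finrank_ker_add_finrank_of_surjective hqs
  rw [Module.finrank_fintype_fun_eq_card, ← firstBetti_eq_finrank] at hcard
  exact ⟨_, w, hcard, hw, by rwa [funext hw']⟩

end Relators

theorem exists_sum_mul_eq_ite {κ ι : Type*} [Fintype κ] [Fintype ι] [DecidableEq κ]
    {v : κ → ι → ℤ} (hv : LinearIndependent ℤ v) :
    ∃ (X : ι → κ → ℤ) (δ : ℤ), δ ≠ 0 ∧ ∀ l m, ∑ i, v l i * X i m = if l = m then δ else 0 := by
  let V : Matrix κ ι ℤ := Matrix.of v
  refine ⟨V.transpose * (V * V.transpose).adjugate, (V * V.transpose).det, fun h0 => ?_,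
    fun l m => ?_⟩
  · obtain ⟨u, hu, h⟩ := Matrix.exists_vecMul_eq_zero_iff.mpr h0
    have h1 : Matrix.vecMul u V = 0 := by
      rw [← dotProduct_self_eq_zero, ← Matrix.mulVec_transpose V u, Matrix.dotProduct_mulVec,
        Matrix.mulVec_transpose, Matrix.vecMul_vecMul, h, zero_dotProduct]
    refine hu (funext fun l => Fintype.linearIndependent_iff.mp hv u ?_ l)
    rw [← h1, Matrix.vecMul_eq_sum]
    rfl
  · have := congrFun (congrFun (Matrix.mul_adjugate (V * V.transpose)) l) m
    rw [Matrix.mul_assoc, Matrix.mul_apply] at this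
    refine this.trans ?_
    simp [Matrix.one_apply]

open scoped Pointwise in
theorem card_add_card_le {α β κ τ : Type*} [Fintype α] [DecidableEq α] [Fintype β]
    [Fintype κ] [Fintype τ]
    {w : κ → FreeGroup α} (hw : LinearIndependent ℤ fun l => (exponentSum (w l)).toAdd)
    (a : τ → FreeGroup α)
    (H : ∀ b : ℕ, ∃ (σ : FreeGroup α →* FreeGroup β) (c : FreeGroup β) (m : τ → ℤ), c ≠ 1 ∧
      (∀ l, σ (w l) = 1) ∧ (∀ j, σ (a j) = c ^ m j) ∧
      ∀ s : τ → ℤ, (∀ j, |s j| < b) → ∑ j, s j * m j = 0 → s = 0) :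
    Fintype.card κ + Fintype.card τ ≤ Fintype.card α := by
  classical
  by_contra! hlt
  obtain ⟨X, δ, hδ, hX⟩ := exists_sum_mul_eq_ite hw
  obtain ⟨p, hp, hp'⟩ := Nat.exists_infinite_primes (δ.natAbs + 1)
  have : Fact p.Prime := ⟨hp'⟩
  have hpδ : ¬ (p : ℤ) ∣ δ := fun hd =>
    (Nat.le_of_dvd (Int.natAbs_pos.2 hδ) (Int.natCast_dvd.mp hd)).not_gt hp
  let E : κ ⊕ τ → α → MonoidAlgebra ℤ (FreeGroup α) := fun x => foxDeriv (Sum.elim w a x)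
  obtain ⟨C, hC⟩ : ∃ C : ℕ, ∀ i, ∑ x, ∑ g ∈ (E x i).coeff.support, |(E x i).coeff g| ≤ C :=
    ⟨_, fun i => (Finset.single_le_sum
      (f := fun i => ∑ x, ∑ g ∈ (E x i).coeff.support, |(E x i).coeff g|)
      (fun _ _ => Finset.sum_nonneg fun _ _ => Finset.sum_nonneg fun _ _ => abs_nonneg _)
      (Finset.mem_univ i)).trans (Int.self_le_toNat _)⟩
  obtain ⟨σ, c, m, hc, hσw, hσa, hm⟩ := H ((2 * C + 1) ^ (2 * Fintype.card α + 1) + 1)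
  obtain ⟨k, ρ, d, hρ, hd, hdc⟩ := exists_unitriangular_isCrossedHom hc
  let ψ : FreeGroup α →* unitriangular k := ρ.comp σ
  let S : Finset (unitriangular k) := Finset.univ.biUnion fun x => Finset.univ.biUnion fun i =>
    (E x i).coeff.support.image ψ
  obtain ⟨B, hB, hBS⟩ := unitriangular.exists_folner S (Fintype.card α)
  obtain ⟨y, hy0, hyb, hy⟩ := exists_ne_zero_sum_mul_groupRingMap_eq_zero ψ E hC
    (by rwa [Fintype.card_sum]) (Nat.lt_succ_self _) (S := S)
    (fun x i g hg => by
      simp only [S, Finset.mem_biUnion, Finset.mem_univ, true_and]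
      exact ⟨x, i, Finset.mem_image_of_mem ψ hg⟩) hB hBS
  have hchain : ∀ u, d (σ u) = ∑ i, groupRingMap ψ (foxDeriv u i) * d (σ (FreeGroup.of i)) :=
    fun u => (hd.comp σ).eq_sum_foxDeriv u
  have hrel : ∑ x, y x * d (σ (Sum.elim w a x)) = 0 := by
    have : ∀ x, y x * d (σ (Sum.elim w a x)) =
        ∑ i, y x * groupRingMap ψ (E x i) * d (σ (FreeGroup.of i)) := fun x => by
      rw [hchain, Finset.mul_sum]
      exact Finset.sum_congr rfl fun i _ => (mul_assoc _ _ _).symm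
    rw [Finset.sum_congr rfl fun x _ => this x]
    rw [Finset.sum_comm]
    simp_rw [← Finset.sum_mul]
    exact Finset.sum_eq_zero fun i _ => by rw [hy, zero_mul]
  have hd1 : d 1 = 0 := hd.map_one
  have hdz : ∀ e : ℤ, d (c ^ e) = e • d c :=
    hd.map_zpow (by rw [MonoidHom.comp_apply, hρ, map_one])
  have hsum : (∑ j, m j • y (Sum.inr j)) * d c = 0 := by
    rw [← hrel, Fintype.sum_sum_type, Finset.sum_mul]
    simp [hσw, hσa, hd1, hdz, -zsmul_eq_mul]
  have hy_inr : ∀ j, y (Sum.inr j) = 0 := fun j => by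
    have h0 := (mul_eq_zero.mp hsum).resolve_right hdc
    ext g
    refine congrFun (hm (fun j => (y (Sum.inr j)).coeff g) (fun j => hyb _ g) ?_) j
    have := congrArg (fun z => z.coeff g) h0
    simpa [mul_comm, Finsupp.finsetSum_apply, -zsmul_eq_mul] using this
  have hy_inl : (fun l => y (Sum.inl l)) = 0 := by
    refine MonoidAlgebra.eq_zero_of_sum_mul_eq_zero (unitriangular.isResiduallyPGroup p)
      (fun l i => groupRingMap ψ (foxDeriv (w l) i)) X hpδ (fun l l' => ?_) _ fun i => ?_
    · simp_rw [lift_groupRingMap, MonoidHom.one_comp, lift_one_foxDeriv]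
      exact hX l l'
    · simpa [E, Fintype.sum_sum_type, hy_inr] using hy i
  exact hy0 (funext fun x => x.casesOn (congrFun hy_inl) hy_inr)

/-- Every abelian subgroup of a limit group with first betti number `n` has rank at most `n`:
any injective homomorphism from the free abelian group `ℤ^r` into such a subgroup forces
`r ≤ n`. -/
theorem abelian_subgroup_rank_le_firstBetti (G : Type*) [Group G]
    (hG : IsLimitGroup G) (n : ℕ) (hn : firstBetti G = n)
    (A : Subgroup G) (hA : ∀ a ∈ A, ∀ b ∈ A, a * b = b * a)
    (r : ℕ) (f : Multiplicative (Fin r → ℤ) →* A) (hf : Function.Injective f) :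
    r ≤ n := by
  classical
  obtain ⟨hfg, hres⟩ := hG
  obtain ⟨α, _, π, hπ⟩ := Group.fg_iff_exists_freeGroup_hom_surjective_finite.mp hfg
  have := Fintype.ofFinite α
  obtain ⟨h, w, hcard, hw, hli⟩ := exists_relators π hπ
  rcases Nat.eq_zero_or_pos r with rfl | hr
  · exact Nat.zero_le n
  choose a ha using fun j : Fin r => hπ (f (Multiplicative.ofAdd (Pi.single j 1)))
  have key := card_add_card_le (β := Fin 2) hli a fun b => by
    let T : Finset (Fin r → ℤ) := insert (Pi.single ⟨0, hr⟩ 1)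
      ((Fintype.piFinset fun _ => Finset.Ioo (-(b : ℤ)) b).erase 0)
    let F : Multiplicative (Fin r → ℤ) →* G := A.subtype.comp f
    have hF : ∀ v ∈ T, F (Multiplicative.ofAdd v) ≠ 1 := fun v hv h1 => by
      have : v = 0 := (injective_iff_map_eq_one f).mp hf _ (Subtype.ext h1)
      subst this
      simp [T, eq_comm (a := (0 : Fin r → ℤ))] at hv
    obtain ⟨φ, hφ⟩ := hres (T.image fun v => F (Multiplicative.ofAdd v)) (by simpa using hF)
    have hφ' : ∀ v ∈ T, φ (F (Multiplicative.ofAdd v)) ≠ 1 := fun v hv =>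
      hφ _ (Finset.mem_image_of_mem _ hv)
    have hcomm : IsMulCommutative (φ.comp F).range := inferInstance
    obtain ⟨⟨c, hc⟩, hgen⟩ :=
      (FreeGroup.isCyclic_of_isMulCommutative (φ.comp F).range).exists_generator
    have hpow : ∀ v, ∃ e : ℤ, φ (F v) = c ^ e := fun v => by
      obtain ⟨e, he⟩ := hgen ⟨φ (F v), v, rfl⟩
      exact ⟨e, (congrArg Subtype.val he).symm⟩
    choose m hm using fun j => hpow (Multiplicative.ofAdd (Pi.single j 1))
    have hsum : ∀ s : Fin r → ℤ, φ (F (Multiplicative.ofAdd s)) = c ^ ∑ j, s j * m j := fun s => by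
      have hs : ∀ t : Finset (Fin r), φ (F (Multiplicative.ofAdd
          (∑ j ∈ t, s j • (Pi.single j 1 : Fin r → ℤ)))) = c ^ ∑ j ∈ t, s j * m j := fun t => by
        induction t using Finset.induction_on with
        | empty => simp
        | insert j t hj ih =>
          rw [Finset.sum_insert hj, Finset.sum_insert hj, ofAdd_add, map_mul, map_mul, ih, zpow_add,
            ofAdd_zsmul, map_zpow, map_zpow, hm, ← zpow_mul, mul_comm (m j)]
      rw [← hs]
      congr 3
      exact pi_eq_sum_univ' s
    refine ⟨φ.comp π, c, m, ?_, fun l => by simp [hw], fun j => ?_, fun s hs h0 => ?_⟩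
    · rintro rfl
      exact hφ' _ (Finset.mem_insert_self _ _) (by rw [hm, one_zpow])
    · rw [← hm, MonoidHom.comp_apply, ha]
      rfl
    · by_contra hs0
      refine hφ' s (Finset.mem_insert_of_mem ?_) (by rw [hsum, h0, zpow_zero])
      simpa [hs0, abs_lt] using hs
  simp only [Fintype.card_fin] at key
  omega
end

section
/- Let φ : G → H be a surjective group homomorphism between limit groups, and let A be a commutative subgroup of G. If the kernel of the restriction of φ to A contains a subgroup isomorphic to ℤ² (equivalently, the kernel contains two elements generating a free abelian group of rank 2), then b₁(H) < b₁(G). -/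
section CopyCounting

variable {β : Type*}

/-- `HasCopies w k L` says that the list `L` contains `k` pairwise disjoint copies of `w` as
contiguous sublists. -/
inductive HasCopies (w : List β) : ℕ → List β → Prop
  | nil : HasCopies w 0 []
  | skip {k : ℕ} {L : List β} (x : β) : HasCopies w k L → HasCopies w k (x :: L)
  | copy {k : ℕ} {L : List β} : HasCopies w k L → HasCopies w (k + 1) (w ++ L)

namespace HasCopies

variable {w u v L : List β} {k l : ℕ}

theorem zero (w L : List β) : HasCopies w 0 L := by
  induction L with
  | nil => exact .nil
  | cons x L ih => exact .skip x ih

theorem append_left (u : List β) (h : HasCopies w k L) : HasCopies w k (u ++ L) := by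
  induction u with
  | nil => exact h
  | cons x u ih => exact .skip x ih

theorem append (hu : HasCopies w k u) (hv : HasCopies w l v) : HasCopies w (k + l) (u ++ v) := by
  induction hu with
  | nil => simpa using hv
  | skip x _ ih => exact .skip x ih
  | copy _ ih =>
    rw [List.append_assoc, add_right_comm]
    exact .copy ih

theorem exists_of_append (h : HasCopies w k (u ++ v)) :
    ∃ k₁ k₂, HasCopies w k₁ u ∧ HasCopies w k₂ v ∧ k ≤ k₁ + k₂ + 1 := by
  generalize hL : u ++ v = L at h
  induction h generalizing u with
  | nil => exact ⟨0, 0, zero _ _, zero _ _, by omega⟩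
  | @skip k L x h ih =>
    cases u with
    | nil =>
      rw [List.nil_append] at hL
      exact ⟨0, k, zero _ _, hL ▸ .skip x h, by omega⟩
    | cons y u =>
      rw [List.cons_append, List.cons.injEq] at hL
      obtain ⟨k₁, k₂, h₁, h₂, hk⟩ := ih hL.2
      exact ⟨k₁, k₂, .skip y h₁, h₂, hk⟩
  | @copy k L h ih =>
    rcases List.append_eq_append_iff.1 hL with ⟨c, -, hv⟩ | ⟨c, hu, hc⟩
    · exact ⟨0, k, zero _ _, hv ▸ h.append_left c, by omega⟩
    · obtain ⟨k₁, k₂, h₁, h₂, hk⟩ := ih hc.symm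
      exact ⟨k₁ + 1, k₂, hu ▸ .copy h₁, h₂, by omega⟩

theorem le_length (hw : w ≠ []) (h : HasCopies w k L) : k ≤ L.length := by
  induction h with
  | nil => simp
  | skip x _ ih => simp; omega
  | copy _ ih =>
    have := List.length_pos_iff.2 hw
    simp; omega

theorem isInfix (h : HasCopies w k L) (hk : k ≠ 0) : w <:+: L := by
  induction h with
  | nil => exact absurd rfl hk
  | skip x _ ih => exact List.infix_cons (ih hk)
  | copy _ _ => exact List.infix_append_left

theorem flatten_replicate (w : List β) (n : ℕ) :
    HasCopies w n (List.replicate n w).flatten := by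
  induction n with
  | zero => exact .nil
  | succ n ih => exact .copy ih

end HasCopies

/-- The maximal number of pairwise disjoint copies of `w` in `L`. -/
noncomputable def copyCount (w L : List β) : ℕ := sSup {k | HasCopies w k L}

variable {w u v L : List β}

theorem bddAbove_hasCopies (hw : w ≠ []) (L : List β) : BddAbove {k | HasCopies w k L} :=
  ⟨L.length, fun _ h => h.le_length hw⟩

theorem hasCopies_copyCount (hw : w ≠ []) (L : List β) : HasCopies w (copyCount w L) L :=
  Nat.sSup_mem ⟨0, HasCopies.zero w L⟩ (bddAbove_hasCopies hw L)

theorem HasCopies.le_copyCount (hw : w ≠ []) {k : ℕ} (h : HasCopies w k L) :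
    k ≤ copyCount w L :=
  le_csSup (bddAbove_hasCopies hw L) h

theorem copyCount_add_le (hw : w ≠ []) (u v : List β) :
    copyCount w u + copyCount w v ≤ copyCount w (u ++ v) :=
  ((hasCopies_copyCount hw u).append (hasCopies_copyCount hw v)).le_copyCount hw

theorem copyCount_append_le (hw : w ≠ []) (u v : List β) :
    copyCount w (u ++ v) ≤ copyCount w u + copyCount w v + 1 := by
  obtain ⟨k₁, k₂, h₁, h₂, h⟩ := (hasCopies_copyCount hw (u ++ v)).exists_of_append
  have := h₁.le_copyCount hw
  have := h₂.le_copyCount hw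
  omega

theorem List.IsInfix.exists_rotation_of_flatten_replicate {n : ℕ}
    (h : w <:+: (List.replicate n u).flatten) (hl : w.length = u.length) :
    ∃ s t, w = s ++ t ∧ u = t ++ s := by
  induction n with
  | zero =>
    obtain rfl : w = [] := by simpa using h
    obtain rfl : u = [] := by simpa using hl.symm
    exact ⟨[], [], rfl, rfl⟩
  | succ n ih =>
    rw [List.replicate_succ, List.flatten_cons, List.infix_append_iff] at h
    rcases h with h | h | ⟨s, t, rfl, hs, ht⟩
    · exact ⟨w, [], by simp, by simp [h.eq_of_length hl]⟩
    · exact ih h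
    · rw [List.length_append] at hl
      have ht : t <+: u := by
        cases n with
        | zero =>
          obtain rfl : t = [] := by simpa using ht
          exact List.nil_prefix
        | succ n =>
          rw [List.replicate_succ, List.flatten_cons] at ht
          exact List.prefix_of_prefix_length_le ht (List.prefix_append _ _) (by omega)
      obtain ⟨c, rfl⟩ := ht
      have hc : s.length = c.length := by
        rw [List.length_append] at hl
        omega
      have hsc : s = c :=
        (List.suffix_of_suffix_length_le hs (List.suffix_append t c) hc.le).eq_of_length hc
      exact ⟨s, t, rfl, by rw [hsc]⟩

end CopyCounting

namespace FreeGroup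

variable {α : Type*}

theorem IsReduced.eq_nil_of_invRev_eq {L : List (α × Bool)} (hL : IsReduced L)
    (h : invRev L = L) : L = [] := by
  classical
  have hinv : (mk L)⁻¹ = mk L := by rw [inv_mk, h]
  rw [← hL.reduce_eq, ← toWord_mk, self_eq_inv.1 hinv.symm, toWord_one]

theorem IsReduced.not_isInfix_flatten_replicate_invRev {w : List (α × Bool)}
    (hred : IsReduced w) (hw : w ≠ []) (n : ℕ) :
    ¬ w <:+: (List.replicate n (invRev w)).flatten := by
  intro h
  obtain ⟨s, t, rfl, hst⟩ := h.exists_rotation_of_flatten_replicate (by simp)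
  rw [invRev_append] at hst
  obtain ⟨ht, hs⟩ := List.append_inj hst (by simp)
  rw [(hred.infix List.infix_append_right).eq_nil_of_invRev_eq ht,
    (hred.infix List.infix_append_left).eq_nil_of_invRev_eq hs] at hw
  exact hw rfl

theorem IsReduced.exists_cancellation {L₁ L₂ : List (α × Bool)} (h₁ : IsReduced L₁)
    (h₂ : IsReduced L₂) :
    ∃ u k v, L₁ = u ++ k ∧ L₂ = invRev k ++ v ∧ IsReduced (u ++ v) := by
  induction L₁ using List.reverseRecOn generalizing L₂ with
  | nil => exact ⟨[], [], L₂, rfl, by simp, h₂⟩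
  | append_singleton L x ih =>
    by_cases hx : ∃ L', L₂ = (x.1, !x.2) :: L'
    · obtain ⟨L', rfl⟩ := hx
      obtain ⟨u, k, v, rfl, rfl, h⟩ := @ih L' (h₁.infix ⟨[], [x], rfl⟩)
        (h₂.infix ⟨[(x.1, !x.2)], [], by simp⟩)
      exact ⟨u, k ++ [x], v, by simp, by simp [invRev], h⟩
    · refine ⟨L ++ [x], [], L₂, by simp, by simp, ?_⟩
      refine List.isChain_append.2 ⟨h₁, h₂, ?_⟩
      rintro a ha b hb hab
      obtain rfl : x = a := by simpa using ha
      by_contra hne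
      cases L₂ with
      | nil => simp at hb
      | cons c L' =>
        obtain rfl : c = b := by simpa using hb
        refine hx ⟨L', ?_⟩
        congr 1
        ext
        · exact hab.symm
        · simpa using (Bool.not_eq.2 (Ne.symm hne))

/-- The difference between the number of disjoint copies of `w` in a word and in its inverse. -/
noncomputable def brooks (w L : List (α × Bool)) : ℤ :=
  copyCount w L - copyCount w (invRev L)

theorem brooks_invRev (w L : List (α × Bool)) : brooks w (invRev L) = -brooks w L := by
  simp [brooks]

theorem abs_brooks_append_sub_le {w : List (α × Bool)} (hw : w ≠ []) (u v : List (α × Bool)) :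
    |brooks w (u ++ v) - brooks w u - brooks w v| ≤ 1 := by
  have h₁ := copyCount_add_le hw u v
  have h₂ := copyCount_append_le hw u v
  have h₃ := copyCount_add_le hw (invRev v) (invRev u)
  have h₄ := copyCount_append_le hw (invRev v) (invRev u)
  rw [brooks, brooks, brooks, invRev_append, abs_le]
  omega

theorem IsReduced.le_brooks_flatten_replicate {w : List (α × Bool)} (hred : IsReduced w)
    (hw : w ≠ []) (n : ℕ) :
    (n : ℤ) ≤ brooks w (List.replicate n w).flatten := by
  have h₁ := (HasCopies.flatten_replicate w n).le_copyCount hw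
  have h₂ : invRev (List.replicate n w).flatten = (List.replicate n (invRev w)).flatten := by
    simp [invRev, List.map_flatten, List.reverse_flatten]
  have h₃ : copyCount w (List.replicate n (invRev w)).flatten = 0 := by
    by_contra h
    exact hred.not_isInfix_flatten_replicate_invRev hw n ((hasCopies_copyCount hw _).isInfix h)
  rw [brooks, h₂, h₃]
  omega

end FreeGroup

/-- A function `q : F → ℤ` that is odd with respect to inversion and is additive up to an error
of at most `3`. -/
structure IsOddQuasimorphism {F : Type*} [Group F] (q : F → ℤ) : Prop where
  inv (x : F) : q x⁻¹ = -q x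
  mul (x y : F) : |q (x * y) - q x - q y| ≤ 3

theorem IsOddQuasimorphism.comp {F G : Type*} [Group F] [Group G] {q : F → ℤ}
    (hq : IsOddQuasimorphism q) (f : G →* F) : IsOddQuasimorphism (q ∘ f) where
  inv x := by simp [hq.inv]
  mul x y := by simpa using hq.mul (f x) (f y)

theorem exists_forall_abs_le_of_mem_commutator {G : Type*} [Group G] {x : G}
    (hx : x ∈ commutator G) :
    ∃ N : ℤ, ∀ q : G → ℤ, IsOddQuasimorphism q → |q x| ≤ N := by
  rw [commutator_eq_closure] at hx
  induction hx using Subgroup.closure_induction with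
  | mem x hx =>
    obtain ⟨a, b, rfl⟩ := hx
    refine ⟨9, fun q hq => ?_⟩
    have h₁ := abs_le.1 (hq.mul a b)
    have h₂ := abs_le.1 (hq.mul (a * b) a⁻¹)
    have h₃ := abs_le.1 (hq.mul (a * b * a⁻¹) b⁻¹)
    rw [hq.inv] at h₂ h₃
    rw [commutatorElement_def, abs_le]
    omega
  | one =>
    refine ⟨0, fun q hq => ?_⟩
    have := hq.inv 1
    rw [inv_one] at this
    rw [abs_le]
    omega
  | mul x y _ _ hx hy =>
    obtain ⟨N, hN⟩ := hx
    obtain ⟨M, hM⟩ := hy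
    refine ⟨N + M + 3, fun q hq => ?_⟩
    have h₁ := abs_le.1 (hN q hq)
    have h₂ := abs_le.1 (hM q hq)
    have h₃ := abs_le.1 (hq.mul x y)
    rw [abs_le]
    omega
  | inv x _ hx =>
    obtain ⟨N, hN⟩ := hx
    exact ⟨N, fun q hq => by rw [hq.inv, abs_neg]; exact hN q hq⟩

namespace FreeGroup

variable {α : Type*}

theorem isOddQuasimorphism_brooks [DecidableEq α] {w : List (α × Bool)} (hw : w ≠ []) :
    IsOddQuasimorphism fun x : FreeGroup α => brooks w x.toWord where
  inv x := by rw [toWord_inv, brooks_invRev]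
  mul x y := by
    obtain ⟨u, k, v, hx, hy, huv⟩ :=
      (isReduced_toWord (x := x)).exists_cancellation (isReduced_toWord (x := y))
    have hxy : (x * y).toWord = u ++ v := by
      rw [← huv.reduce_eq, toWord_mul, hx, hy]
      apply reduce.sound
      simp only [← mul_mk, ← inv_mk]
      group
    have h₁ := abs_le.1 (abs_brooks_append_sub_le hw u k)
    have h₂ := abs_le.1 (abs_brooks_append_sub_le hw (invRev k) v)
    have h₃ := abs_le.1 (abs_brooks_append_sub_le hw u v)
    rw [brooks_invRev] at h₂
    rw [hxy, hx, hy, abs_le]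
    omega

theorem exists_isOddQuasimorphism_le_pow {z : FreeGroup α} (hz : z ≠ 1) :
    ∃ q : FreeGroup α → ℤ, IsOddQuasimorphism q ∧ ∀ n : ℕ, (n : ℤ) ≤ q (z ^ n) := by
  classical
  set w := reduceCyclically z.toWord with hw_def
  set c := mk (reduceCyclically.conjugator z.toWord) with hc
  have hzw : z = c * mk w * c⁻¹ := by
    rw [hc, inv_mk, mul_mk, mul_mk, reduceCyclically.conj_conjugator_reduceCyclically, mk_toWord]
  have hw : w ≠ [] := by
    intro h
    rw [h] at hzw
    exact hz (by rw [hzw, ← one_eq_mk, mul_one, mul_inv_cancel])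
  refine ⟨_, (isOddQuasimorphism_brooks hw).comp (MulAut.conj c⁻¹).toMonoidHom, fun n => ?_⟩
  have hconj : MulAut.conj c⁻¹ (z ^ n) = mk (List.replicate n w).flatten := by
    rw [map_pow, ← pow_mk, hzw]
    congr 1
    simp [mul_assoc]
  have hcyc : IsCyclicallyReduced w := reduceCyclically.isCyclicallyReduced isReduced_toWord
  simp only [Function.comp_apply, MulEquiv.toMonoidHom_eq_coe, MonoidHom.coe_coe, hconj,
    toWord_mk, (hcyc.flatten_replicate n).isReduced.reduce_eq]
  exact hcyc.isReduced.le_brooks_flatten_replicate hw n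

theorem subsingleton_of_commute (h : ∀ x y : FreeGroup α, x * y = y * x) : Subsingleton α where
  allEq a b := by
    classical
    have := congrArg toWord (h (of a) (of b))
    simp [toWord_mul, reduce.cons] at this
    exact this.1

theorem exists_forall_mem_zpowers (α : Type*) [Subsingleton α] :
    ∃ g : FreeGroup α, ∀ x, x ∈ Subgroup.zpowers g := by
  rcases isEmpty_or_nonempty α with hα | ⟨⟨a⟩⟩
  · exact ⟨1, fun x => by rw [Subsingleton.elim x 1]; exact one_mem _⟩
  · refine ⟨of a, fun x => ?_⟩
    have hx : x ∈ Subgroup.closure (Set.range (of : α → FreeGroup α)) := by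
      rw [closure_range_of]
      trivial
    refine (Subgroup.closure_le _).2 ?_ hx
    rintro _ ⟨b, rfl⟩
    rw [Subsingleton.elim b a]
    exact Subgroup.mem_zpowers _

theorem exists_zpow_of_commute {x y : FreeGroup α} (h : Commute x y) :
    ∃ (z : FreeGroup α) (m n : ℤ), x = z ^ m ∧ y = z ^ n := by
  let K := Subgroup.closure {x, y}
  have hK : IsMulCommutative K := Subgroup.isMulCommutative_closure (by
    rintro a (rfl | rfl) b (rfl | rfl)
    exacts [rfl, h, h.symm, rfl])
  let e : FreeGroup (IsFreeGroup.Generators K) ≃* K := IsFreeGroup.mulEquiv K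
  have := subsingleton_of_commute fun a b => e.injective (by
    rw [e.map_mul, e.map_mul]
    exact hK.is_comm.comm _ _)
  obtain ⟨g, hg⟩ := exists_forall_mem_zpowers (IsFreeGroup.Generators K)
  have hz : ∀ a ∈ K, ∃ m : ℤ, a = (e g : FreeGroup α) ^ m := by
    intro a ha
    obtain ⟨m, hm⟩ := hg (e.symm ⟨a, ha⟩)
    refine ⟨m, ?_⟩
    have := congrArg (fun b => (e b : FreeGroup α)) hm
    simpa using this.symm
  obtain ⟨m, hm⟩ := hz x (Subgroup.subset_closure (by simp))
  obtain ⟨n, hn⟩ := hz y (Subgroup.subset_closure (by simp))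
  exact ⟨_, m, n, hm, hn⟩

end FreeGroup

open TensorProduct in
theorem exists_zpow_mem_commutator_of_tmul_eq_zero {G : Type*} [Group G] {x : G}
    (hx : (1 : ℚ) ⊗ₜ[ℤ] Additive.ofMul (Abelianization.of x) = 0) :
    ∃ n : ℤ, n ≠ 0 ∧ x ^ n ∈ commutator G := by
  have hloc : IsLocalizedModule (nonZeroDivisors ℤ)
      (TensorProduct.mk ℤ ℚ (Additive (Abelianization G)) 1) :=
    (isLocalizedModule_iff_isBaseChange (nonZeroDivisors ℤ) ℚ _).2 (TensorProduct.isBaseChange ..)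
  obtain ⟨n, hn⟩ := (IsLocalizedModule.eq_zero_iff (nonZeroDivisors ℤ)
    (TensorProduct.mk ℤ ℚ (Additive (Abelianization G)) 1)).1 hx
  refine ⟨n, nonZeroDivisors.coe_ne_zero n, ?_⟩
  rw [← Abelianization.ker_of, MonoidHom.mem_ker, map_zpow]
  exact congrArg Additive.toMul hn

open TensorProduct in
theorem tmul_eq_zero_of_firstBetti_le {G H : Type*} [Group G] [Group H] [Group.FG G]
    (φ : G →* H) (hφ : Function.Surjective φ) (hb : firstBetti G ≤ firstBetti H) {x : G}
    (hx : φ x = 1) :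
    (1 : ℚ) ⊗ₜ[ℤ] Additive.ofMul (Abelianization.of x) = 0 := by
  have : Module.Finite ℤ (Additive (Abelianization G)) := by
    rw [Module.Finite.iff_addGroup_fg, ← GroupFG.iff_add_fg]
    exact QuotientGroup.fg _
  let ψ : Additive (Abelianization G) →ₗ[ℤ] Additive (Abelianization H) :=
    (Abelianization.map φ).toAdditive.toIntLinearMap
  have hψ : Function.Surjective ψ := by
    intro y
    obtain ⟨h, hh⟩ := QuotientGroup.mk_surjective y.toMul
    obtain ⟨g, rfl⟩ := hφ h
    exact ⟨Additive.ofMul (Abelianization.of g), hh⟩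
  let Ψ := ψ.baseChange ℚ
  have hΨ : Function.Surjective Ψ := LinearMap.lTensor_surjective ℚ hψ
  have hrank := Ψ.finrank_range_add_finrank_ker
  rw [LinearMap.range_eq_top.2 hΨ, finrank_top] at hrank
  have hker : LinearMap.ker Ψ = ⊥ := by
    rw [← Submodule.finrank_eq_zero (R := ℚ)]
    unfold firstBetti at hb
    omega
  refine LinearMap.ker_eq_bot'.1 hker _ ?_
  have hψx : ψ (Additive.ofMul (Abelianization.of x)) = 0 := by
    change Additive.ofMul (Abelianization.of (φ x)) = 0
    rw [hx, map_one, ofMul_one]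
  simp [Ψ, hψx]

theorem IsLimitGroup.not_mem_commutator {G : Type*} [Group G] (hG : IsLimitGroup G) {a b : G}
    (hab : Commute a b) (hfree : ∀ i j : ℤ, a ^ i * b ^ j = 1 → i = 0 ∧ j = 0)
    (ha : a ∈ commutator G) : b ∉ commutator G := by
  classical
  intro hb
  obtain ⟨N, hN⟩ := exists_forall_abs_le_of_mem_commutator ha
  obtain ⟨M, hM⟩ := exists_forall_abs_le_of_mem_commutator hb
  set K : ℤ := max 1 (max N M)
  let S : Finset G := (((Finset.Icc (-K) K) ×ˢ (Finset.Icc (-K) K)).erase (0, 0)).image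
    fun p => a ^ p.1 * b ^ p.2
  obtain ⟨f, hf⟩ := hG.2 S (by
    intro s hs
    simp only [S, Finset.mem_image, Finset.mem_erase] at hs
    obtain ⟨⟨i, j⟩, ⟨hne, -⟩, rfl⟩ := hs
    intro h
    obtain ⟨rfl, rfl⟩ := hfree i j h
    exact hne rfl)
  have hS : ∀ i j : ℤ, |i| ≤ K → |j| ≤ K → f (a ^ i * b ^ j) = 1 → i = 0 ∧ j = 0 := by
    intro i j hi hj h
    by_contra hne
    refine hf _ (Finset.mem_image.2 ⟨(i, j), ?_, rfl⟩) h
    simpa [Prod.ext_iff, ← abs_le, hi, hj] using hne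
  have hfa : f a ≠ 1 := fun h => by
    have := hS 1 0 (by simp [K]) (by simp [K]) (by simpa using h)
    omega
  obtain ⟨z, m, n, hm, hn⟩ := FreeGroup.exists_zpow_of_commute (hab.map f)
  have hz : z ≠ 1 := by
    rintro rfl
    exact hfa (by simpa using hm)
  obtain ⟨q, hq, hqz⟩ := FreeGroup.exists_isOddQuasimorphism_le_pow hz
  have hle : ∀ k : ℤ, |k| ≤ |q (z ^ k)| := by
    intro k
    obtain ⟨l, rfl | rfl⟩ := k.eq_nat_or_neg
    · rw [Nat.abs_cast, zpow_natCast]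
      exact (hqz l).trans (le_abs_self _)
    · rw [abs_neg, Nat.abs_cast, zpow_neg, hq.inv, abs_neg, zpow_natCast]
      exact (hqz l).trans (le_abs_self _)
  have hmK : |m| ≤ K := by
    have := hN _ (hq.comp f)
    rw [Function.comp_apply, hm] at this
    exact (hle m).trans (this.trans (by simp [K]))
  have hnK : |n| ≤ K := by
    have := hM _ (hq.comp f)
    rw [Function.comp_apply, hn] at this
    exact (hle n).trans (this.trans (by simp [K]))
  obtain ⟨-, hm0⟩ := hS n (-m) hnK (by rwa [abs_neg]) (by
    rw [map_mul, map_zpow, map_zpow, hm, hn, ← zpow_mul, ← zpow_mul, ← zpow_add]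
    rw [show m * n + n * -m = 0 by ring, zpow_zero])
  exact hfa (by rw [hm, neg_eq_zero.1 hm0, zpow_zero])

/-- If `φ : G ↠ H` is a surjection of limit groups, `A ≤ G` is a commutative subgroup, and
the kernel of the restriction of `φ` to `A` contains a copy of `ℤ²`, then
`b₁(H) < b₁(G)`. -/
theorem firstBetti_lt_of_Z2_in_kernel (G H : Type*) [Group G] [Group H]
    (hG : IsLimitGroup G) (hH : IsLimitGroup H)
    (φ : G →* H) (hφ : Function.Surjective φ)
    (A : Subgroup G) (hA : ∀ a ∈ A, ∀ b ∈ A, a * b = b * a)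
    (hker : ∃ f : Multiplicative (Fin 2 → ℤ) →* G, Function.Injective f ∧
      (∀ x, f x ∈ A) ∧ (∀ x, φ (f x) = 1)) :
    firstBetti H < firstBetti G := by
  have := hG.1
  by_contra! hb
  obtain ⟨f, hf, -, hφf⟩ := hker
  let e (i j : ℤ) : Multiplicative (Fin 2 → ℤ) := Multiplicative.ofAdd ![i, j]
  obtain ⟨m, hm0, hm⟩ := exists_zpow_mem_commutator_of_tmul_eq_zero
    (tmul_eq_zero_of_firstBetti_le φ hφ hb (hφf (e 1 0)))
  obtain ⟨n, hn0, hn⟩ := exists_zpow_mem_commutator_of_tmul_eq_zero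
    (tmul_eq_zero_of_firstBetti_le φ hφ hb (hφf (e 0 1)))
  rw [← map_zpow] at hm hn
  refine hG.not_mem_commutator ((Commute.all _ _).map f) (fun i j h => ?_) hm hn
  rw [← map_zpow f, ← map_zpow f, ← map_mul f, ← map_one f] at h
  have h' := congrArg Multiplicative.toAdd (hf h)
  have h0 := congrFun h' 0
  have h1 := congrFun h' 1
  simp [e, hm0, hn0] at h0 h1
  exact ⟨h0, h1⟩
end

section
/- Let G be a limit group and A a commutative subgroup of G. Then the subgroup of A consisting of those elements whose image in the abelianization of G is a torsion element has rank at most one; in particular it contains no subgroup isomorphic to ℤ². -/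
namespace CountingQuasimorphism

/-- `HasCopies w n L` says that the word `L` contains `n` pairwise disjoint copies of `w`. -/
inductive HasCopies {β : Type*} (w : List β) : ℕ → List β → Prop
  | zero (L : List β) : HasCopies w 0 L
  | succ {n : ℕ} {L : List β} (x : List β) (h : HasCopies w n L) :
      HasCopies w (n + 1) (x ++ (w ++ L))

/-- The largest number of pairwise disjoint copies of `w` in the word `L`. -/
noncomputable def copyCount {β : Type*} (w L : List β) : ℕ := sSup {n | HasCopies w n L}

section Words

variable {β : Type*} {w : List β}

theorem HasCopies.prepend {n : ℕ} {L : List β} (h : HasCopies w n L) (y : List β) :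
    HasCopies w n (y ++ L) := by
  cases h with
  | zero => exact .zero _
  | succ x h => simpa using HasCopies.succ (y ++ x) h

theorem HasCopies.append {m n : ℕ} {L₁ L₂ : List β} (h₁ : HasCopies w m L₁)
    (h₂ : HasCopies w n L₂) : HasCopies w (m + n) (L₁ ++ L₂) := by
  induction h₁ with
  | zero L => simpa using h₂.prepend L
  | succ x _ ih => simpa [add_right_comm] using HasCopies.succ x ih

theorem HasCopies.le_length (hw : w ≠ []) {n : ℕ} {L : List β} (h : HasCopies w n L) :
    n ≤ L.length := by
  have := List.length_pos_iff.2 hw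
  induction h with
  | zero L => simp
  | succ x _ ih => simp; omega

theorem HasCopies.split {n : ℕ} {L₁ L₂ : List β} (h : HasCopies w n (L₁ ++ L₂)) :
    ∃ i j, HasCopies w i L₁ ∧ HasCopies w j L₂ ∧ n ≤ i + j + 1 := by
  generalize hL : L₁ ++ L₂ = L at h
  induction h generalizing L₁ with
  | zero L => exact ⟨0, 0, .zero _, .zero _, by omega⟩
  | @succ n L x h ih =>
    rw [← List.append_assoc] at hL
    rcases List.append_eq_append_iff.1 hL with ⟨y, _, rfl⟩ | ⟨y, rfl, rfl⟩
    · exact ⟨0, n, .zero _, h.prepend y, by omega⟩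
    · obtain ⟨i, j, hi, hj, hij⟩ := ih rfl
      exact ⟨i + 1, j, by simpa using hi.succ x, hj, by omega⟩

theorem HasCopies.isInfix {n : ℕ} {L : List β} (h : HasCopies w (n + 1) L) : w <:+: L := by
  cases h with
  | succ x h => exact ⟨x, _, List.append_assoc _ _ _⟩

theorem hasCopies_flatten_replicate (w : List β) (n : ℕ) :
    HasCopies w n (List.replicate n w).flatten := by
  induction n with
  | zero => exact .zero _
  | succ n ih => simpa [List.replicate_succ] using ih.succ []

theorem HasCopies.le_copyCount (hw : w ≠ []) {n : ℕ} {L : List β} (h : HasCopies w n L) :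
    n ≤ copyCount w L :=
  le_csSup ⟨L.length, fun _ hm => HasCopies.le_length hw hm⟩ h

theorem hasCopies_copyCount (hw : w ≠ []) (L : List β) : HasCopies w (copyCount w L) L :=
  Nat.sSup_mem (s := {n | HasCopies w n L}) ⟨0, .zero _⟩
    ⟨L.length, fun _ hm => HasCopies.le_length hw hm⟩

theorem copyCount_add_le (hw : w ≠ []) (L₁ L₂ : List β) :
    copyCount w L₁ + copyCount w L₂ ≤ copyCount w (L₁ ++ L₂) :=
  ((hasCopies_copyCount hw L₁).append (hasCopies_copyCount hw L₂)).le_copyCount hw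

theorem copyCount_append_le (hw : w ≠ []) (L₁ L₂ : List β) :
    copyCount w (L₁ ++ L₂) ≤ copyCount w L₁ + copyCount w L₂ + 1 := by
  obtain ⟨i, j, hi, hj, hij⟩ := (hasCopies_copyCount hw (L₁ ++ L₂)).split
  have := hi.le_copyCount hw
  have := hj.le_copyCount hw
  omega

theorem copyCount_eq_zero (hw : w ≠ []) {L : List β} (h : ¬ w <:+: L) : copyCount w L = 0 := by
  have := hasCopies_copyCount hw L
  match hn : copyCount w L with
  | 0 => rfl
  | n + 1 => exact absurd (hn ▸ this).isInfix h

/-- A word of the same length as `v` occurring in a power of `v` is a cyclic rotation of `v`. -/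
theorem exists_rotation_of_isInfix_flatten_replicate {v : List β} (hv : v ≠ [])
    (hlen : w.length = v.length) {n : ℕ} (h : w <:+: (List.replicate n v).flatten) :
    ∃ s z, v = s ++ z ∧ w = z ++ s := by
  have hpos := List.length_pos_iff.2 hv
  induction n with
  | zero => simp at h; simp [h] at hlen; omega
  | succ n ih =>
    obtain ⟨s, t, h⟩ := h
    rw [List.replicate_succ, List.flatten_cons, List.append_assoc] at h
    rcases List.append_eq_append_iff.1 h with ⟨z, hz, h'⟩ | ⟨y, -, h'⟩
    · refine ⟨s, z, hz, ?_⟩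
      cases n with
      | zero =>
        have h1 := congrArg List.length h'
        have h2 := congrArg List.length hz
        simp at h1 h2
        have hs : s = [] := List.length_eq_zero_iff.1 (by omega)
        have ht : t = [] := List.length_eq_zero_iff.1 (by omega)
        subst hs ht
        simpa using h'
      | succ n =>
        rw [List.replicate_succ, List.flatten_cons, hz] at h'
        refine (List.append_inj (t₁ := t)
          (t₂ := z ++ (List.replicate n (s ++ z)).flatten) (by simpa using h') ?_).1
        simp [hlen, hz, add_comm]
    · exact ih ⟨y, t, by simpa using h'.symm⟩

end Words

open FreeGroup

variable {α : Type*}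

/-- Maximal cancellation in the product of two reduced words. -/
theorem exists_cancellation {L₁ L₂ : List (α × Bool)} (h₁ : IsReduced L₁) (h₂ : IsReduced L₂) :
    ∃ u v t, L₁ = u ++ v ∧ L₂ = invRev v ++ t ∧ IsReduced (u ++ t) := by
  induction L₂ generalizing L₁ with
  | nil => exact ⟨L₁, [], [], by simp, by simp, by simpa using h₁⟩
  | cons b L₂ ih =>
    rcases L₁.eq_nil_or_concat with rfl | ⟨L, a, rfl⟩
    · exact ⟨[], [], b :: L₂, rfl, rfl, h₂⟩
    · by_cases hab : a.1 = b.1 → a.2 = b.2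
      · refine ⟨L ++ [a], [], b :: L₂, by simp, by simp, ?_⟩
        rw [FreeGroup.IsReduced, List.isChain_append]
        exact ⟨by simpa [FreeGroup.IsReduced] using h₁, h₂, by simpa using hab⟩
      · obtain ⟨u, v, t, rfl, rfl, h⟩ := ih (L₁ := L)
          (List.isChain_append.1 (List.concat_eq_append ▸ h₁)).1 (List.IsChain.tail h₂)
        refine ⟨u, v ++ [a], t, by simp, ?_, h⟩
        obtain ⟨a, p⟩ := a
        obtain ⟨b, q⟩ := b
        push Not at hab
        obtain ⟨rfl, hpq⟩ := hab
        cases p <;> cases q <;> simp_all [invRev]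

theorem exists_toWord_mul [DecidableEq α] (x y : FreeGroup α) :
    ∃ u v t, x.toWord = u ++ v ∧ y.toWord = invRev v ++ t ∧ (x * y).toWord = u ++ t := by
  obtain ⟨u, v, t, hx, hy, h⟩ :=
    exists_cancellation (isReduced_toWord (x := x)) (isReduced_toWord (x := y))
  refine ⟨u, v, t, hx, hy, ?_⟩
  have hxy : x * y = mk (u ++ t) := by
    rw [← mk_toWord (x := x), ← mk_toWord (x := y), hx, hy]
    simp only [← mul_mk, ← inv_mk]
    group
  rw [hxy, toWord_mk, h.reduce_eq]

/-- An antisymmetric integer-valued quasimorphism of defect at most `3`. -/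
structure IsQuasimorphism {G : Type*} [Group G] (φ : G → ℤ) : Prop where
  map_inv : ∀ x, φ x⁻¹ = -φ x
  map_mul : ∀ x y, |φ (x * y) - φ x - φ y| ≤ 3

theorem IsQuasimorphism.comp {G H : Type*} [Group G] [Group H] {φ : H → ℤ}
    (hφ : IsQuasimorphism φ) (h : G →* H) : IsQuasimorphism (fun x => φ (h x)) :=
  ⟨fun x => by simp [hφ.map_inv], fun x y => by simpa using hφ.map_mul (h x) (h y)⟩

/-- On an element of the commutator subgroup all these quasimorphisms are uniformly bounded. -/
theorem exists_bound_of_mem_commutator {G : Type*} [Group G] {x : G} (hx : x ∈ commutator G) :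
    ∃ K : ℤ, ∀ φ : G → ℤ, IsQuasimorphism φ → |φ x| ≤ K := by
  rw [commutator_eq_closure] at hx
  induction hx using Subgroup.closure_induction with
  | mem x hx =>
    obtain ⟨a, b, rfl⟩ := hx
    refine ⟨9, fun φ hφ => ?_⟩
    have h₁ := hφ.map_mul a b
    have h₂ := hφ.map_mul (a * b) a⁻¹
    have h₃ := hφ.map_mul (a * b * a⁻¹) b⁻¹
    rw [hφ.map_inv] at h₂ h₃
    rw [commutatorElement_def]
    rw [abs_le] at *
    constructor <;> linarith
  | one =>
    refine ⟨3, fun φ hφ => ?_⟩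
    simpa using hφ.map_mul 1 1
  | mul x y _ _ ihx ihy =>
    obtain ⟨K, hK⟩ := ihx
    obtain ⟨M, hM⟩ := ihy
    refine ⟨K + M + 3, fun φ hφ => ?_⟩
    have h₁ := hφ.map_mul x y
    have h₂ := hK φ hφ
    have h₃ := hM φ hφ
    rw [abs_le] at *
    constructor <;> linarith
  | inv x _ ih =>
    obtain ⟨K, hK⟩ := ih
    exact ⟨K, fun φ hφ => by simpa [hφ.map_inv] using hK φ hφ⟩

/-- The counting quasimorphism of Brooks, counting disjoint copies of the word `w`. -/
noncomputable def brooks [DecidableEq α] (w : List (α × Bool)) (x : FreeGroup α) : ℤ :=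
  copyCount w x.toWord - copyCount w x⁻¹.toWord

theorem isQuasimorphism_brooks [DecidableEq α] {w : List (α × Bool)} (hw : w ≠ []) :
    IsQuasimorphism (brooks w) := by
  refine ⟨fun x => by simp [brooks], fun x y => ?_⟩
  obtain ⟨u, v, t, hx, hy, hxy⟩ := exists_toWord_mul x y
  simp only [brooks, toWord_inv, hx, hy, hxy, invRev_append, invRev_invRev]
  have := copyCount_add_le hw u v
  have := copyCount_append_le hw u v
  have := copyCount_add_le hw (invRev v) (invRev u)
  have := copyCount_append_le hw (invRev v) (invRev u)
  have := copyCount_add_le hw (invRev v) t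
  have := copyCount_append_le hw (invRev v) t
  have := copyCount_add_le hw (invRev t) v
  have := copyCount_append_le hw (invRev t) v
  have := copyCount_add_le hw u t
  have := copyCount_append_le hw u t
  have := copyCount_add_le hw (invRev t) (invRev u)
  have := copyCount_append_le hw (invRev t) (invRev u)
  rw [abs_le]
  constructor <;> omega

theorem eq_nil_of_isReduced_of_eq_invRev {z : List (α × Bool)} (h : IsReduced z)
    (hz : z = invRev z) : z = [] := by
  classical
  have h1 : (mk z) ^ 2 = 1 := by
    rw [sq]
    nth_rewrite 2 [hz]
    rw [← inv_mk, mul_inv_cancel]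
  have h2 : mk z = 1 := (pow_eq_one_iff_left (by norm_num)).1 h1
  rw [← h.reduce_eq, ← toWord_mk, h2, toWord_one]

theorem not_isInfix_flatten_replicate_invRev {w : List (α × Bool)} (h : IsReduced w)
    (hw : w ≠ []) (n : ℕ) : ¬ w <:+: (List.replicate n (invRev w)).flatten := by
  intro hn
  have hw' : invRev w ≠ [] := by simpa [invRev] using hw
  obtain ⟨s, z, hv, rfl⟩ :=
    exists_rotation_of_isInfix_flatten_replicate hw' (by simp) hn
  rw [invRev_append] at hv
  obtain ⟨hs, hz⟩ := List.append_inj hv (by simp)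
  have hs' := eq_nil_of_isReduced_of_eq_invRev (List.isChain_append.1 h).2.1 hs.symm
  have hz' := eq_nil_of_isReduced_of_eq_invRev (List.isChain_append.1 h).1 hz.symm
  simp [hs', hz'] at hw

theorem invRev_flatten_replicate (w : List (α × Bool)) (n : ℕ) :
    invRev (List.replicate n w).flatten = (List.replicate n (invRev w)).flatten := by
  induction n with
  | zero => simp
  | succ n ih =>
    rw [List.replicate_succ, List.flatten_cons, invRev_append, ih, List.replicate_succ',
      List.flatten_concat]

theorem le_brooks_pow [DecidableEq α] {w : List (α × Bool)} (h : IsCyclicallyReduced w)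
    (hw : w ≠ []) (n : ℕ) : (n : ℤ) ≤ brooks w (mk w ^ n) := by
  have hpow : (mk w ^ n).toWord = (List.replicate n w).flatten := by
    rw [toWord_pow, toWord_mk, h.isReduced.reduce_eq, (h.flatten_replicate n).isReduced.reduce_eq]
  rw [brooks, toWord_inv, hpow, invRev_flatten_replicate,
    copyCount_eq_zero hw (not_isInfix_flatten_replicate_invRev h.isReduced hw n)]
  simpa using (hasCopies_flatten_replicate w n).le_copyCount hw

theorem abs_le_abs_brooks_zpow [DecidableEq α] {w : List (α × Bool)} (h : IsCyclicallyReduced w)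
    (hw : w ≠ []) (p : ℤ) : |p| ≤ |brooks w (mk w ^ p)| := by
  obtain ⟨n, rfl | rfl⟩ := p.eq_nat_or_neg
  · simpa using (le_brooks_pow h hw n).trans (le_abs_self _)
  · rw [zpow_neg, (isQuasimorphism_brooks hw).map_inv]
    simpa using (le_brooks_pow h hw n).trans (le_abs_self _)

/-- Every nontrivial element of a free group has powers of linearly growing commutator length,
with a uniform rate: it is detected by a quasimorphism of defect at most `3`. -/
theorem exists_isQuasimorphism_zpow {w : FreeGroup α} (hw : w ≠ 1) :
    ∃ φ : FreeGroup α → ℤ, IsQuasimorphism φ ∧ ∀ p : ℤ, |p| ≤ |φ (w ^ p)| := by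
  classical
  set c := reduceCyclically.conjugator w.toWord
  set v := reduceCyclically w.toWord
  have hconj : w = mk c * mk v * (mk c)⁻¹ := by
    rw [inv_mk, mul_mk, mul_mk, reduceCyclically.conj_conjugator_reduceCyclically, mk_toWord]
  have hv' : v ≠ [] := by
    intro h
    rw [h] at hconj
    rw [← one_eq_mk, mul_one, mul_inv_cancel] at hconj
    exact hw hconj
  have hred : IsCyclicallyReduced v := reduceCyclically.isCyclicallyReduced isReduced_toWord
  refine ⟨_, (isQuasimorphism_brooks hv').comp (MulAut.conj (mk c)⁻¹).toMonoidHom, fun p => ?_⟩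
  have hp : (MulAut.conj (mk c)⁻¹).toMonoidHom (w ^ p) = mk v ^ p := by
    rw [map_zpow, hconj]
    congr 1
    change (mk c)⁻¹ * (mk c * mk v * (mk c)⁻¹) * (mk c)⁻¹⁻¹ = mk v
    group
  rw [hp]
  exact abs_le_abs_brooks_zpow hred hv' p

/-- If `x` is torsion in the abelianization of `G`, then the exponents of the images of `x` under
homomorphisms to free groups are bounded. -/
theorem exists_exponent_bound {G : Type*} [Group G] {x : G}
    (hx : IsOfFinOrder (Abelianization.of x)) :
    ∃ K : ℤ, ∀ (h : G →* FreeGroup α) (w : FreeGroup α) (p : ℤ), w ≠ 1 → h x = w ^ p →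
      |p| ≤ K := by
  obtain ⟨n, hn, hxn⟩ := isOfFinOrder_iff_pow_eq_one.1 hx
  rw [← map_pow, ← MonoidHom.mem_ker, Abelianization.ker_of] at hxn
  obtain ⟨K, hK⟩ := exists_bound_of_mem_commutator hxn
  refine ⟨K, fun h w p hw hp => ?_⟩
  obtain ⟨φ, hφ, hφw⟩ := exists_isQuasimorphism_zpow hw
  have h₁ := hK _ (hφ.comp h)
  rw [map_pow, hp, ← zpow_natCast, ← zpow_mul] at h₁
  have h₂ := (hφw (p * n)).trans h₁
  rw [abs_mul, Nat.abs_cast] at h₂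
  have hn' : (1 : ℤ) ≤ n := by exact_mod_cast hn
  nlinarith [abs_nonneg p]

theorem eq_of_of_mul_of_comm {x y : α} (h : of x * of y = of y * of x) : x = y := by
  classical
  have := congrArg toWord h
  simp [toWord_mul, reduce.cons] at this
  exact this.1

theorem isCyclic_of_isFreeGroup {H : Type*} [Group H] [IsFreeGroup H]
    (hc : ∀ a b : H, a * b = b * a) : IsCyclic H := by
  let e := IsFreeGroup.toFreeGroup H
  have hsub : Subsingleton (IsFreeGroup.Generators H) :=
    ⟨fun x y => eq_of_of_mul_of_comm (e.symm.injective (by simp [hc]))⟩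
  have : IsCyclic (FreeGroup (IsFreeGroup.Generators H)) := by
    rcases isEmpty_or_nonempty (IsFreeGroup.Generators H) with h | ⟨⟨x⟩⟩
    · infer_instance
    · have : Unique (IsFreeGroup.Generators H) := uniqueOfSubsingleton x
      infer_instance
  exact isCyclic_of_surjective e.symm e.symm.surjective

theorem exists_zpow_of_commute {x y : FreeGroup α} (h : Commute x y) :
    ∃ (w : FreeGroup α) (p q : ℤ), x = w ^ p ∧ y = w ^ q := by
  let H := Subgroup.closure {x, y}
  have hc : ∀ a b : H, a * b = b * a := by
    have hmul : ∀ a ∈ ({x, y} : Set (FreeGroup α)), ∀ b ∈ ({x, y} : Set (FreeGroup α)),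
        a * b = b * a := by
      rintro a (rfl | rfl) b (rfl | rfl)
      exacts [rfl, h, h.symm, rfl]
    exact (Subgroup.isMulCommutative_closure hmul).is_comm.comm
  have := isCyclic_of_isFreeGroup hc
  obtain ⟨w, hw⟩ := IsCyclic.exists_generator (α := H)
  obtain ⟨p, hp⟩ := hw ⟨x, Subgroup.subset_closure (by simp)⟩
  obtain ⟨q, hq⟩ := hw ⟨y, Subgroup.subset_closure (by simp)⟩
  exact ⟨w, p, q, by simpa using (congrArg Subtype.val hp).symm,
    by simpa using (congrArg Subtype.val hq).symm⟩

/-- In a fully residually free group, two commuting elements which are torsion in the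
abelianization are multiplicatively dependent. -/
theorem exists_zpow_mul_zpow_eq_one {G : Type*} [Group G]
    (hG : ∀ S : Finset G, (∀ s ∈ S, s ≠ 1) →
      ∃ f : G →* FreeGroup (Fin 2), ∀ s ∈ S, f s ≠ 1)
    {a b : G} (hab : Commute a b) (ha : IsOfFinOrder (Abelianization.of a))
    (hb : IsOfFinOrder (Abelianization.of b)) :
    ∃ m n : ℤ, (m ≠ 0 ∨ n ≠ 0) ∧ a ^ m * b ^ n = 1 := by
  classical
  by_contra! hne
  obtain ⟨K, hK⟩ := exists_exponent_bound (α := Fin 2) ha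
  obtain ⟨M, hM⟩ := exists_exponent_bound (α := Fin 2) hb
  have ha1 : a ≠ 1 := by simpa using hne 1 0 (by simp)
  let S : Finset G := insert a
    (((Finset.Icc (-M) M ×ˢ Finset.Icc (-K) K).filter fun i => i.1 ≠ 0 ∨ i.2 ≠ 0).image
      fun i => a ^ i.1 * b ^ i.2)
  obtain ⟨h, hh⟩ := hG S (by
    intro s hs
    rcases Finset.mem_insert.1 hs with rfl | hs
    · exact ha1
    · obtain ⟨i, hi, rfl⟩ := Finset.mem_image.1 hs
      exact hne _ _ (Finset.mem_filter.1 hi).2)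
  obtain ⟨w, p, q, hp, hq⟩ := exists_zpow_of_commute (hab.map h)
  have hha : h a ≠ 1 := hh a (Finset.mem_insert_self _ _)
  have hw : w ≠ 1 := by rintro rfl; simp [hp] at hha
  have hp0 : p ≠ 0 := by rintro rfl; simp [hp] at hha
  have hpK := abs_le.1 (hK h w p hw hp)
  have hqM := abs_le.1 (hM h w q hw hq)
  refine hh (a ^ q * b ^ (-p)) (Finset.mem_insert_of_mem (Finset.mem_image.2
    ⟨(q, -p), Finset.mem_filter.2 ⟨?_, Or.inr (neg_ne_zero.2 hp0)⟩, rfl⟩)) ?_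
  · simp only [Finset.mem_product, Finset.mem_Icc]
    omega
  · rw [MonoidHom.map_mul, map_zpow, map_zpow, hp, hq, ← zpow_mul, ← zpow_mul, ← zpow_add,
      show p * q + q * -p = 0 by ring, zpow_zero]

end CountingQuasimorphism

/-- Let `G` be a limit group and `A` a commutative subgroup.  The subgroup of `A` consisting
of elements whose image in the abelianization of `G` is torsion has rank at most one:
any injective homomorphism of `ℤ^r` into `G` landing in `A`, all of whose values become
torsion in `G^{ab}`, forces `r ≤ 1`.  In particular this subgroup contains no copy of `ℤ²`. -/
theorem rank_le_one_of_dies_rationally (G : Type*) [Group G]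
    (hG : IsLimitGroup G)
    (A : Subgroup G) (hA : ∀ a ∈ A, ∀ b ∈ A, a * b = b * a)
    (r : ℕ) (f : Multiplicative (Fin r → ℤ) →* G)
    (hf : Function.Injective f) (hfA : ∀ x, f x ∈ A)
    (htor : ∀ x, IsOfFinOrder (Abelianization.of (f x))) :
    r ≤ 1 := by
  by_contra! hr
  let e (i : Fin r) : Multiplicative (Fin r → ℤ) := Multiplicative.ofAdd (Pi.single i 1)
  let i : Fin r := ⟨0, by omega⟩
  let j : Fin r := ⟨1, by omega⟩
  have hij : i ≠ j := by simp [i, j]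
  obtain ⟨m, n, hmn, h⟩ := CountingQuasimorphism.exists_zpow_mul_zpow_eq_one hG.2
    (hA _ (hfA (e i)) _ (hfA (e j))) (htor (e i)) (htor (e j))
  rw [← map_zpow f, ← map_zpow f, ← map_mul f] at h
  have h0 := congrArg Multiplicative.toAdd ((injective_iff_map_eq_one f).1 hf _ h)
  have hi := congrFun h0 i
  have hj := congrFun h0 j
  simp [e, hij, hij.symm] at hi hj
  omega
end

section
/- Big powers in free groups: let F be a free group and let t, g₀, g₁, …, g_m be nontrivial elements of F such that gᵢ t ≠ t gᵢ for every i = 0, …, m. Then there exists a natural number N such that for all integers n₁, …, n_m with |nᵢ| ≥ N for every i, the element g₀ t^{n₁} g₁ t^{n₂} g₂ ⋯ g_{m−1} t^{n_m} g_m of F is not the identity. -/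
namespace FreeGroup

section PrefixGeometry

variable {α : Type*} [DecidableEq α]

theorem exists_toWord_mul_eq_append (x y : FreeGroup α) :
    ∃ U V Z : List (α × Bool), x.toWord = U ++ invRev V ∧ y.toWord = V ++ Z ∧
      (x * y).toWord = U ++ Z := by
  have common_prefix : ∀ X Y : List (α × Bool), ∃ P A B, X = P ++ A ∧ Y = P ++ B ∧
      ∀ a ∈ A.head?, ∀ b ∈ B.head?, a ≠ b := by
    intro X
    induction X with
    | nil => exact fun Y => ⟨[], [], Y, by simp⟩
    | cons a X ih =>
      rintro (_ | ⟨b, Y⟩)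
      · exact ⟨[], a :: X, [], by simp⟩
      by_cases hab : a = b
      · obtain ⟨P, A, B, rfl, rfl, h⟩ := ih Y
        exact ⟨a :: P, A, B, rfl, by simp [hab], h⟩
      · exact ⟨[], a :: X, b :: Y, rfl, rfl, by simpa using hab⟩
  obtain ⟨P, A, B, hx, hy, h⟩ := common_prefix x⁻¹.toWord y.toWord
  have hx' : x.toWord = invRev A ++ invRev P := by
    rw [← invRev_append, ← hx, toWord_inv, invRev_invRev]
  refine ⟨invRev A, P, B, hx', hy, ?_⟩
  have hred : IsReduced (invRev A ++ B) := by
    refine List.IsChain.append ?_ ?_ ?_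
    · exact List.IsChain.left_of_append (hx' ▸ isReduced_toWord (x := x))
    · exact List.IsChain.right_of_append (hy ▸ isReduced_toWord (x := y))
    · rintro ⟨c, d⟩ hc ⟨b, e⟩ hb hcb
      simp only [invRev, List.getLast?_reverse, List.head?_map, Option.mem_def,
        Option.map_eq_some_iff] at hc
      obtain ⟨⟨a, f⟩, ha, hac⟩ := hc
      have := h _ ha _ hb
      cases d <;> cases e <;> simp_all
  rw [← hred.reduce_eq, ← toWord_mk, ← mul_mk, ← mk_toWord (x := x), ← mk_toWord (x := y), hx',
    hy, ← mul_mk, ← mul_mk, ← inv_mk (L := P)]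
  group

/-- The reduced words of `x` and `y` share their first `ℓ` letters. -/
def SharePrefix (ℓ : ℕ) (x y : FreeGroup α) : Prop :=
  ℓ ≤ x.norm ∧ ℓ ≤ y.norm ∧ x.toWord.take ℓ = y.toWord.take ℓ

namespace SharePrefix

variable {ℓ k : ℕ} {x y z : FreeGroup α}

theorem trans (h : SharePrefix ℓ x y) (h' : SharePrefix ℓ y z) : SharePrefix ℓ x z :=
  ⟨h.1, h'.2.1, h.2.2.trans h'.2.2⟩

theorem mono (h : SharePrefix ℓ x y) (hk : k ≤ ℓ) : SharePrefix k x y := by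
  refine ⟨hk.trans h.1, hk.trans h.2.1, ?_⟩
  rw [← min_eq_left hk, ← List.take_take, h.2.2, List.take_take]

theorem norm_inv_mul_add_le (h : SharePrefix ℓ x y) :
    norm (x⁻¹ * y) + 2 * ℓ ≤ norm x + norm y := by
  obtain ⟨hx, hy, heq⟩ := h
  have key : x⁻¹ * y = (mk (x.toWord.drop ℓ))⁻¹ * mk (y.toWord.drop ℓ) := by
    conv_lhs => rw [← mk_toWord (x := x), ← mk_toWord (x := y),
      ← List.take_append_drop ℓ x.toWord, ← List.take_append_drop ℓ y.toWord, heq,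
      ← mul_mk, ← mul_mk]
    group
  have h₁ := norm_mul_le (mk (x.toWord.drop ℓ))⁻¹ (mk (y.toWord.drop ℓ))
  have h₂ := norm_mk_le (L₁ := x.toWord.drop ℓ)
  have h₃ := norm_mk_le (L₁ := y.toWord.drop ℓ)
  rw [← key, norm_inv_eq] at h₁
  simp only [List.length_drop] at h₂ h₃
  simp only [norm] at *
  omega

theorem of_norm_inv_mul_lt (h : norm (x⁻¹ * y) + 2 * ℓ < norm x + norm y) :
    SharePrefix (ℓ + 1) x y := by
  obtain ⟨U, V, Z, hx, hy, hxy⟩ := exists_toWord_mul_eq_append x⁻¹ y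
  have hx' : x.toWord = V ++ invRev U := by
    rw [← invRev_invRev (L₁ := x.toWord), ← toWord_inv, hx, invRev_append, invRev_invRev]
  simp only [norm, hxy, hx', hy, List.length_append, invRev_length] at h
  have hV : ℓ + 1 ≤ V.length := by omega
  refine ⟨?_, ?_, ?_⟩
  · simp only [norm, hx', List.length_append]; omega
  · simp only [norm, hy, List.length_append]; omega
  · rw [hx', hy, List.take_append_of_le_length hV, List.take_append_of_le_length hV]

end SharePrefix

/-- Local-to-global principle: a product of long factors with little cancellation between
consecutive factors is at least as long as its first factor. -/
theorem sharePrefix_prod_cons (c : ℕ) (x : FreeGroup α) (l : List (FreeGroup α))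
    (hlong : ∀ y ∈ x :: l, 2 * c < norm y)
    (hchain : (x :: l).IsChain fun y z => ¬ SharePrefix (c + 1) y⁻¹ z) :
    SharePrefix (c + 1) (x :: l).prod x ∧ norm x ≤ norm (x :: l).prod := by
  induction l generalizing x with
  | nil =>
    have := hlong x (by simp)
    simp only [List.prod_cons, List.prod_nil, mul_one, le_refl, and_true]
    exact ⟨by omega, by omega, rfl⟩
  | cons y l ih =>
    rw [List.isChain_cons_cons] at hchain
    obtain ⟨hshare, hle⟩ := ih y (fun z hz => hlong z (List.mem_cons_of_mem _ hz)) hchain.2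
    rw [List.prod_cons]
    set q := (y :: l).prod
    have hx := hlong x (by simp)
    have hy := hlong y (by simp)
    have hq : norm x + norm q ≤ norm (x * q) + 2 * c := by
      by_contra! hlt
      refine hchain.1 (.trans (.of_norm_inv_mul_lt ?_) hshare)
      rwa [inv_inv, norm_inv_eq]
    refine ⟨.of_norm_inv_mul_lt ?_, by omega⟩
    have : norm ((x * q)⁻¹ * x) = norm q := by simp [mul_assoc]
    omega

end PrefixGeometry

section Powers

theorem eq_one_of_conj_eq_inv {α : Type*} {g b : FreeGroup α} (h : g * b * g⁻¹ = b⁻¹) : b = 1 := by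
  have h' : g * b = b⁻¹ * g := by rw [← h]; group
  have hsq : (g * b) ^ 2 = g ^ 2 := by
    calc (g * b) ^ 2 = g * b * (g * b) := sq _
      _ = g * b * (b⁻¹ * g) := by rw [h']
      _ = g ^ 2 := by rw [sq]; group
  simpa using pow_left_injective two_ne_zero hsq

variable {α : Type*} [DecidableEq α]

theorem IsCyclicallyReduced.invRev {L : List (α × Bool)} (h : IsCyclicallyReduced L) :
    IsCyclicallyReduced (invRev L) := by
  refine ⟨?_, ?_⟩
  · rw [isReduced_iff_reduce_eq, reduce_invRev, h.isReduced.reduce_eq]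
  · rintro ⟨a, d⟩ ha ⟨b, e⟩ hb hab
    simp only [FreeGroup.invRev, List.getLast?_reverse, List.head?_reverse, List.head?_map,
      List.getLast?_map, Option.mem_def, Option.map_eq_some_iff] at ha hb
    obtain ⟨p, hp, hpa⟩ := ha
    obtain ⟨q, hq, hqb⟩ := hb
    have := h.2 q hq p hp
    grind

theorem toWord_pow_of_isCyclicallyReduced {s : FreeGroup α} (hs : IsCyclicallyReduced s.toWord)
    (n : ℕ) : (s ^ n).toWord = (List.replicate n s.toWord).flatten := by
  rw [toWord_pow, (hs.flatten_replicate n).isReduced.reduce_eq]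

theorem norm_pow_of_isCyclicallyReduced {s : FreeGroup α} (hs : IsCyclicallyReduced s.toWord)
    (n : ℕ) : norm (s ^ n) = n * norm s := by
  simp [norm, toWord_pow_of_isCyclicallyReduced hs]

theorem norm_zpow_of_isCyclicallyReduced {s : FreeGroup α} (hs : IsCyclicallyReduced s.toWord)
    (n : ℤ) : norm (s ^ n) = n.natAbs * norm s := by
  obtain ⟨k, rfl | rfl⟩ := n.eq_nat_or_neg <;> simp [norm_pow_of_isCyclicallyReduced hs]

theorem exists_isCyclicallyReduced_conj (t : FreeGroup α) :
    ∃ u s : FreeGroup α, IsCyclicallyReduced s.toWord ∧ t = u * s * u⁻¹ := by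
  have hred := reduceCyclically.isCyclicallyReduced (isReduced_toWord (x := t))
  refine ⟨mk (reduceCyclically.conjugator t.toWord), mk (reduceCyclically t.toWord), ?_, ?_⟩
  · rwa [toWord_mk, hred.isReduced.reduce_eq]
  · rw [inv_mk, mul_mk, mul_mk, reduceCyclically.conj_conjugator_reduceCyclically, mk_toWord]

theorem mk_take_toWord_pow {s : FreeGroup α} (hs : IsCyclicallyReduced s.toWord) {n ℓ : ℕ}
    (h : ℓ + norm s ≤ norm (s ^ n)) :
    mk ((s ^ n).toWord.take (ℓ + norm s)) = s * mk ((s ^ n).toWord.take ℓ) := by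
  rw [norm_pow_of_isCyclicallyReduced hs] at h
  simp only [toWord_pow_of_isCyclicallyReduced hs]
  cases n with
  | zero =>
    have : s = 1 := norm_eq_zero.1 (by omega)
    simp [this]
  | succ n =>
    have hℓ : ℓ ≤ (List.replicate n s.toWord).flatten.length := by
      simp only [List.length_flatten, List.map_replicate, List.sum_replicate, smul_eq_mul]
      rw [add_mul, one_mul] at h
      simp only [norm] at h
      omega
    conv_rhs => rw [List.replicate_succ', List.flatten_concat, List.take_append_of_le_length hℓ]
    rw [List.replicate_succ, List.flatten_cons, norm, add_comm ℓ, List.take_length_add_append,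
      ← mul_mk, mk_toWord]

theorem exists_mk_take_toWord_mul (x y : FreeGroup α) :
    ∃ p q : ℕ, p ≤ norm x ∧ norm (x * y) + q = norm y + p ∧
      ∀ ℓ, p ≤ ℓ → mk ((x * y).toWord.take ℓ) = x * mk (y.toWord.take (ℓ - p + q)) := by
  obtain ⟨U, V, Z, hx, hy, hxy⟩ := exists_toWord_mul_eq_append x y
  refine ⟨U.length, V.length, by simp [norm, hx], by simp [norm, hxy, hy]; omega, ?_⟩
  intro ℓ hℓ
  obtain ⟨k, rfl⟩ := Nat.exists_eq_add_of_le hℓ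
  rw [hxy, hy, List.take_length_add_append, Nat.add_sub_cancel_left, add_comm k,
    List.take_length_add_append, ← mk_toWord (x := x), hx, ← mul_mk, ← mul_mk, ← mul_mk, ← inv_mk]
  group

theorem eq_conj_of_sharePrefix_pow {a b g : FreeGroup α} (ha : IsCyclicallyReduced a.toWord)
    (hb : IsCyclicallyReduced b.toWord) (hab : norm a = norm b) {i j : ℕ}
    (h : SharePrefix (norm g + norm a) (a ^ i) (g * b ^ j)) : a = g * b * g⁻¹ := by
  obtain ⟨p, q, hp, hpq, htake⟩ := exists_mk_take_toWord_mul g (b ^ j)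
  have hlen := h.2.1
  have hA := mk_take_toWord_pow ha h.1
  have hB := mk_take_toWord_pow hb (n := j) (ℓ := norm g - p + q) (by omega)
  rw [h.2.2, (h.mono (Nat.le_add_right _ _)).2.2, htake _ (by omega), htake _ hp,
    show norm g + norm a - p + q = norm g - p + q + norm b by omega, hB] at hA
  rw [eq_mul_inv_iff_mul_eq]
  simpa only [← mul_assoc, mul_left_inj] using hA.symm

theorem norm_zpow_add_norm_zpow_le_of_isCyclicallyReduced {s g : FreeGroup α}
    (hs : IsCyclicallyReduced s.toWord) (h : g * s ≠ s * g) (n k : ℤ) :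
    norm (s ^ n) + norm (s ^ k) ≤ norm (s ^ n * g * s ^ k) + (3 * norm g + 2 * norm s) := by
  by_contra! hlt
  have hs1 : s ≠ 1 := by rintro rfl; simp at h
  have zpow_eq_pow : ∀ m : ℤ, ∃ (a : FreeGroup α) (i : ℕ), (a = s ∨ a = s⁻¹) ∧ s ^ m = a ^ i := by
    intro m
    obtain ⟨i, rfl | rfl⟩ := m.eq_nat_or_neg
    · exact ⟨s, i, .inl rfl, by simp⟩
    · exact ⟨s⁻¹, i, .inr rfl, by simp⟩
  have hred : ∀ a : FreeGroup α, a = s ∨ a = s⁻¹ →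
      IsCyclicallyReduced a.toWord ∧ norm a = norm s := by
    rintro a (rfl | rfl)
    · exact ⟨hs, rfl⟩
    · exact ⟨toWord_inv s ▸ hs.invRev, norm_inv_eq⟩
  obtain ⟨a, i, ha, hai⟩ := zpow_eq_pow (-n)
  obtain ⟨b, j, hb, hbj⟩ := zpow_eq_pow k
  have hshare : SharePrefix (norm g + norm s + 1) (a ^ i) (g * b ^ j) := by
    rw [← hai, ← hbj]
    refine .of_norm_inv_mul_lt ?_
    have h₁ := norm_mul_le g⁻¹ (g * s ^ k)
    rw [inv_mul_cancel_left, norm_inv_eq] at h₁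
    rw [zpow_neg, inv_inv, norm_inv_eq, ← mul_assoc]
    omega
  obtain ⟨hca, hna⟩ := hred a ha
  obtain ⟨hcb, hnb⟩ := hred b hb
  have hconj := eq_conj_of_sharePrefix_pow hca hcb (hna.trans hnb.symm)
    (hshare.mono (by omega) : SharePrefix (norm g + norm a) _ _)
  rcases ha with rfl | rfl <;> rcases hb with rfl | rfl
  · exact h (eq_mul_inv_iff_mul_eq.1 hconj).symm
  · exact hs1 (inv_eq_one.1 (eq_one_of_conj_eq_inv (by rw [← hconj, inv_inv])))
  · exact hs1 (eq_one_of_conj_eq_inv hconj.symm)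
  · rw [← conj_inv, inv_inj] at hconj
    exact h (eq_mul_inv_iff_mul_eq.1 hconj).symm

theorem norm_conj_le (u x : FreeGroup α) : norm (u * x * u⁻¹) ≤ norm x + 2 * norm u := by
  have h₁ := norm_mul_le (u * x) u⁻¹
  have h₂ := norm_mul_le u x
  rw [norm_inv_eq] at h₁
  omega

theorem norm_le_norm_conj (u x : FreeGroup α) : norm x ≤ norm (u * x * u⁻¹) + 2 * norm u := by
  have := norm_conj_le u⁻¹ (u * x * u⁻¹)
  rwa [norm_inv_eq, show u⁻¹ * (u * x * u⁻¹) * u⁻¹⁻¹ = x by group] at this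

/-- Powers of `t` separated by an element not commuting with `t` cancel boundedly. -/
theorem exists_norm_zpow_add_norm_zpow_le {t g : FreeGroup α} (h : g * t ≠ t * g) :
    ∃ c : ℕ, ∀ n k : ℤ, norm (t ^ n) + norm (t ^ k) ≤ norm (t ^ n * g * t ^ k) + c := by
  obtain ⟨u, s, hs, rfl⟩ := exists_isCyclicallyReduced_conj t
  obtain ⟨g, rfl⟩ : ∃ g', g = u * g' * u⁻¹ := ⟨u⁻¹ * g * u, by group⟩
  have h' : g * s ≠ s * g := by
    intro heq
    apply h
    rw [conj_mul, conj_mul, heq]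
  refine ⟨3 * norm g + 2 * norm s + 6 * norm u, fun n k => ?_⟩
  rw [conj_zpow, conj_zpow, conj_mul, conj_mul]
  have h₁ := norm_zpow_add_norm_zpow_le_of_isCyclicallyReduced hs h' n k
  have h₂ := norm_conj_le u (s ^ n)
  have h₃ := norm_conj_le u (s ^ k)
  have h₄ := norm_le_norm_conj u (s ^ n * g * s ^ k)
  omega

theorem exists_natAbs_le_norm_zpow (t : FreeGroup α) (ht : t ≠ 1) :
    ∃ c : ℕ, ∀ n : ℤ, n.natAbs ≤ norm (t ^ n) + c := by
  obtain ⟨u, s, hs, rfl⟩ := exists_isCyclicallyReduced_conj t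
  have hs1 : 0 < norm s := by
    rw [Nat.pos_iff_ne_zero, Ne, norm_eq_zero]
    rintro rfl
    simp at ht
  refine ⟨2 * norm u, fun n => ?_⟩
  have h := norm_le_norm_conj u (s ^ n)
  rw [← conj_zpow, norm_zpow_of_isCyclicallyReduced hs] at h
  exact (Nat.le_mul_of_pos_right n.natAbs hs1).trans h

/-- Consecutive factors `t ^ n * g i` cancel boundedly, as `sharePrefix_prod_cons` requires. -/
theorem exists_forall_not_sharePrefix_zpow_mul {ι : Type*} [Finite ι] {t : FreeGroup α}
    {g : ι → FreeGroup α} (h : ∀ i, g i * t ≠ t * g i) :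
    ∃ c : ℕ, ∀ i j, ∀ n k : ℤ, ¬ SharePrefix (c + 1) (t ^ n * g i)⁻¹ (t ^ k * g j) := by
  choose c hc using fun i => exists_norm_zpow_add_norm_zpow_le (h i)
  obtain ⟨C, hC⟩ := (Set.finite_range c).bddAbove
  obtain ⟨G, hG⟩ := (Set.finite_range fun i => norm (g i)).bddAbove
  rw [mem_upperBounds, Set.forall_mem_range] at hC hG
  refine ⟨C + 3 * G, fun i j n k hshare => ?_⟩
  have h₁ := hshare.norm_inv_mul_add_le
  rw [inv_inv, norm_inv_eq, ← mul_assoc] at h₁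
  have h₂ := norm_mul_le (t ^ n) (g i)
  have h₃ := norm_mul_le (t ^ k) (g j)
  have h₄ := norm_mul_le (t ^ n * g i * t ^ k * g j) (g j)⁻¹
  rw [mul_inv_cancel_right, norm_inv_eq] at h₄
  have h₅ := hc i n k
  have := hC i
  have := hG i
  have := hG j
  omega

end Powers

end FreeGroup

/-- **Big powers in free groups.**  Let `t, g 0, …, g m` be nontrivial elements of a free
group such that no `g i` commutes with `t`.  Then there is `N : ℕ` such that whenever all
the exponents `n i` satisfy `|n i| ≥ N`, the element
`g 0 * t ^ (n 0) * g 1 * t ^ (n 1) * ⋯ * t ^ (n (m-1)) * g m` is nontrivial. -/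
theorem big_powers_in_free_groups (α : Type*) (m : ℕ)
    (t : FreeGroup α) (g : Fin (m + 1) → FreeGroup α)
    (ht : t ≠ 1) (hg : ∀ i, g i ≠ 1)
    (hcomm : ∀ i, g i * t ≠ t * g i) :
    ∃ N : ℕ, ∀ n : Fin m → ℤ, (∀ i, (N : ℤ) ≤ |n i|) →
      g 0 * (List.ofFn fun i : Fin m => t ^ (n i) * g i.succ).prod ≠ 1 := by
  classical
  obtain ⟨c, hc⟩ := FreeGroup.exists_forall_not_sharePrefix_zpow_mul hcomm
  obtain ⟨d, hd⟩ := FreeGroup.exists_natAbs_le_norm_zpow t ht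
  obtain ⟨G, hG⟩ := (Set.finite_range fun i => (g i).norm).bddAbove
  rw [mem_upperBounds, Set.forall_mem_range] at hG
  refine ⟨d + 2 * c + 2 * G + 1, fun n hn => ?_⟩
  have hlong : ∀ i : Fin m, 2 * c + G < (t ^ n i * g i.succ).norm := by
    intro i
    have h₁ := hd (n i)
    have h₂ := FreeGroup.norm_mul_le (t ^ n i * g i.succ) (g i.succ)⁻¹
    rw [mul_inv_cancel_right, FreeGroup.norm_inv_eq] at h₂
    have := hG i.succ
    have := Int.abs_eq_natAbs (n i) ▸ hn i
    omega
  cases m with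
  | zero => simpa using hg 0
  | succ m =>
    intro hone
    have hmem : ∀ y ∈ List.ofFn fun i : Fin (m + 1) => t ^ n i * g i.succ,
        ∃ i, t ^ n i * g i.succ = y := fun y hy => by
      simpa only [List.mem_ofFn, Set.mem_range] using hy
    have hchain : (List.ofFn fun i : Fin (m + 1) => t ^ n i * g i.succ).IsChain
        fun y z => ¬ FreeGroup.SharePrefix (c + 1) y⁻¹ z := by
      refine (List.pairwise_of_forall_mem_list fun y hy z hz => ?_).isChain
      obtain ⟨i, rfl⟩ := hmem y hy
      obtain ⟨j, rfl⟩ := hmem z hz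
      exact hc _ _ _ _
    rw [List.ofFn_succ] at hone hmem hchain
    have hle := (FreeGroup.sharePrefix_prod_cons c _ _ (fun y hy => by
      obtain ⟨i, rfl⟩ := hmem y hy
      exact (Nat.le_add_right _ _).trans_lt (hlong i)) hchain).2
    rw [← inv_eq_of_mul_eq_one_right hone, FreeGroup.norm_inv_eq] at hle
    have := hlong 0
    have := hG 0
    omega
end

section
/- Let G be a nonabelian limit group and A a commutative subgroup of G. Then the first betti number of G relative to A is at least one: there exists a surjective group homomorphism f : G → ℤ whose kernel contains A. -/
theorem IsFreeGroup.subsingleton_generators_of_commute {F : Type*} [Group F] [IsFreeGroup F]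
    (h : ∀ a b : F, a * b = b * a) : Subsingleton (IsFreeGroup.Generators F) := by
  classical
  refine ⟨fun x y => by_contra fun hxy => ?_⟩
  let φ : F →* Equiv.Perm (Fin 3) := IsFreeGroup.lift
    fun z => if z = x then Equiv.swap 0 1 else Equiv.swap 1 2
  have hφ := congrArg φ (h (IsFreeGroup.of x) (IsFreeGroup.of y))
  simp only [map_mul, φ, IsFreeGroup.lift_of, if_true, if_neg (Ne.symm hxy)] at hφ
  exact absurd hφ (by decide)

theorem IsFreeGroup.isCyclic_of_subsingleton_generators {F : Type*} [Group F] [IsFreeGroup F]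
    [Subsingleton (IsFreeGroup.Generators F)] : IsCyclic F := by
  have e := IsFreeGroup.toFreeGroup F
  rcases isEmpty_or_nonempty (IsFreeGroup.Generators F) with _ | ⟨⟨x⟩⟩
  · have := e.toEquiv.subsingleton
    infer_instance
  · have := uniqueOfSubsingleton x
    exact (MulEquiv.isCyclic e).2 inferInstance

theorem IsFreeGroup.isCyclic_of_commute {F : Type*} [Group F] [IsFreeGroup F]
    (h : ∀ a b : F, a * b = b * a) : IsCyclic F :=
  have := subsingleton_generators_of_commute h
  isCyclic_of_subsingleton_generators

theorem IsFreeGroup.exists_ne_generators_of_not_commute {F : Type*} [Group F] [IsFreeGroup F]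
    (h : ∃ a b : F, a * b ≠ b * a) : ∃ x y : IsFreeGroup.Generators F, x ≠ y := by
  by_contra! hall
  have : Subsingleton (IsFreeGroup.Generators F) := ⟨hall⟩
  have := isCyclic_of_subsingleton_generators (F := F)
  obtain ⟨a, b, hab⟩ := h
  exact hab (IsCyclic.isMulCommutative.is_comm.comm a b)

theorem IsFreeGroup.exists_hom_int_ne_one {F : Type*} [Group F] [IsFreeGroup F]
    (h : ∃ a b : F, a * b ≠ b * a) (c : F) :
    ∃ g : F →* Multiplicative ℤ, g ≠ 1 ∧ g c = 1 := by
  classical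
  obtain ⟨x, y, hxy⟩ := exists_ne_generators_of_not_commute h
  let p : IsFreeGroup.Generators F → (F →* Multiplicative ℤ) := fun z =>
    IsFreeGroup.lift fun w => if w = z then Multiplicative.ofAdd 1 else 1
  have hp : ∀ z w, p z (IsFreeGroup.of w) = if w = z then Multiplicative.ofAdd 1 else 1 :=
    fun z w => IsFreeGroup.lift_of _ _
  by_cases hx : p x c = 1
  · refine ⟨p x, fun h1 => ?_, hx⟩
    have := hp x x
    rw [h1, MonoidHom.one_apply, if_pos rfl] at this
    exact absurd this (by decide)
  · refine ⟨p x ^ (p y c).toAdd * p y ^ (-(p x c).toAdd), fun h1 => hx ?_, ?_⟩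
    · have := DFunLike.congr_fun h1 (IsFreeGroup.of y)
      simpa [hp, hxy, hxy.symm, ← ofAdd_zsmul] using this
    · apply Multiplicative.toAdd.injective
      simp [mul_comm]

theorem MonoidHom.exists_surjective_int_of_ne_one {G : Type*} [Group G]
    (g : G →* Multiplicative ℤ) (hg : g ≠ 1) :
    ∃ f : G →* Multiplicative ℤ, Function.Surjective f ∧ f.ker = g.ker := by
  have : Nontrivial g.range := by
    rw [Subgroup.nontrivial_iff_ne_bot]
    exact fun h => hg (MonoidHom.range_eq_bot_iff.1 h)
  have : Infinite g.range := by
    obtain ⟨a, ha⟩ := exists_ne (1 : g.range)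
    exact Infinite.of_injective (fun n : ℤ => a ^ n)
      (injective_zpow_iff_not_isOfFinOrder.2 (not_isOfFinOrder_of_isMulTorsionFree ha))
  have e : g.range ≃* Multiplicative ℤ := intCyclicMulEquiv.symm
  refine ⟨e.toMonoidHom.comp g.rangeRestrict,
    e.surjective.comp g.rangeRestrict_surjective, ?_⟩
  ext a
  simp [MonoidHom.mem_ker]

/-- A nonabelian limit group has first betti number at least one relative to any commutative
subgroup `A`: there is a surjection `G ↠ ℤ` killing `A`. -/
theorem exists_surjection_to_Z_killing_abelian (G : Type*) [Group G]
    (hG : IsLimitGroup G) (hnab : ∃ x y : G, x * y ≠ y * x)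
    (A : Subgroup G) (hA : ∀ a ∈ A, ∀ b ∈ A, a * b = b * a) :
    ∃ f : G →* Multiplicative ℤ, Function.Surjective f ∧ ∀ a ∈ A, f a = 1 := by
  obtain ⟨x, y, hxy⟩ := hnab
  obtain ⟨f, hf⟩ := hG.2 {x * y * (y * x)⁻¹} (by
    simpa only [Finset.mem_singleton, forall_eq, Ne, mul_inv_eq_one] using hxy)
  have hfxy : f x * f y ≠ f y * f x := by
    have := hf _ (Finset.mem_singleton_self _)
    rwa [map_mul, map_inv, Ne, mul_inv_eq_one, map_mul, map_mul] at this
  have hcyc : IsCyclic (A.map f) := by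
    refine IsFreeGroup.isCyclic_of_commute ?_
    rintro ⟨_, a, ha, rfl⟩ ⟨_, b, hb, rfl⟩
    exact Subtype.ext (by simpa using congrArg f (hA a ha b hb))
  obtain ⟨⟨_, c, hc, rfl⟩, hgen⟩ := hcyc.exists_generator
  obtain ⟨g, hg, hgc⟩ := IsFreeGroup.exists_hom_int_ne_one (F := f.range)
    ⟨f.rangeRestrict x, f.rangeRestrict y, fun h => hfxy (congrArg Subtype.val h)⟩
    (f.rangeRestrict c)
  obtain ⟨φ, hφ, hker⟩ := (g.comp f.rangeRestrict).exists_surjective_int_of_ne_one fun h =>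
    hg ((MonoidHom.cancel_right f.rangeRestrict_surjective).1 h)
  refine ⟨φ, hφ, fun a ha => ?_⟩
  rw [← MonoidHom.mem_ker, hker, MonoidHom.mem_ker, MonoidHom.comp_apply]
  obtain ⟨n, hn⟩ := Subgroup.mem_zpowers_iff.1 (hgen ⟨f a, a, ha, rfl⟩)
  have : f.rangeRestrict a = f.rangeRestrict c ^ n :=
    Subtype.ext (by simpa using (congrArg Subtype.val hn).symm)
  rw [this, map_zpow, hgc, one_zpow]
end

section
/- Let H be a limit group, ι a finite nonempty index type, (Gᵢ)_{i ∈ ι} a family of groups, and G their free product (the coproduct of the family in the category of groups). Suppose G is finitely generated and π : G → H is a group homomorphism whose image is a nonabelian subgroup of H and whose restriction to the canonical copy of each factor Gᵢ in G is injective. Then G is a limit group, i.e. G is fully residually free. -/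
/-- The translation action of the infinite cyclic group on the free group with basis `ℤ`. -/
def FreeGroup.translation : Multiplicative ℤ →* MulAut (FreeGroup ℤ) where
  toFun n := FreeGroup.freeGroupCongr (Equiv.addLeft n.toAdd)
  map_one' := MulEquiv.toMonoidHom_injective <| by
    ext; simp
  map_mul' m n := MulEquiv.toMonoidHom_injective <| by
    ext; simp [add_assoc]

/-- The elements `aⁿ b a⁻ⁿ` freely generate a free subgroup of the free group on `a` and `b`. -/
theorem FreeGroup.injective_lift_conj_zpow :
    Function.Injective (FreeGroup.lift fun n : ℤ =>
      (FreeGroup.of 0 : FreeGroup (Fin 2)) ^ n * FreeGroup.of 1 * FreeGroup.of 0 ^ (-n)) := by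
  let ψ : FreeGroup (Fin 2) →* FreeGroup ℤ ⋊[FreeGroup.translation] Multiplicative ℤ :=
    FreeGroup.lift ![SemidirectProduct.inr (Multiplicative.ofAdd 1),
      SemidirectProduct.inl (FreeGroup.of 0)]
  have key : ψ.comp (FreeGroup.lift fun n : ℤ =>
      (FreeGroup.of 0 : FreeGroup (Fin 2)) ^ n * FreeGroup.of 1 * FreeGroup.of 0 ^ (-n)) =
      SemidirectProduct.inl := by
    ext1 n
    have h := SemidirectProduct.inl_aut (φ := FreeGroup.translation) (Multiplicative.ofAdd n)
      (FreeGroup.of 0)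
    have h' : FreeGroup.translation (Multiplicative.ofAdd n) (FreeGroup.of 0) =
        FreeGroup.of n := by
      simp [FreeGroup.translation]
    rw [h'] at h
    have hn : Multiplicative.ofAdd n = Multiplicative.ofAdd 1 ^ n := by
      rw [← ofAdd_zsmul]; simp
    simp [ψ, h, hn]
  refine Function.Injective.of_comp (f := ψ) ?_
  rw [← MonoidHom.coe_comp, key]
  exact SemidirectProduct.inl_injective

/-- A free group of countable rank embeds in the free group of rank two. -/
theorem FreeGroup.exists_injective_of_countable (α : Type*) [Countable α] :
    ∃ f : FreeGroup α →* FreeGroup (Fin 2), Function.Injective f := by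
  obtain ⟨e, he⟩ := Countable.exists_injective_nat α
  exact ⟨(FreeGroup.lift _).comp (FreeGroup.map fun a => (e a : ℤ)),
    FreeGroup.injective_lift_conj_zpow.comp
      (FreeGroup.map_injective (Nat.cast_injective.comp he))⟩

/-- A family of homomorphisms between factors that kills no letter of a reduced word does not kill
the element of the free product represented by that word. -/
theorem Monoid.CoprodI.Word.lift_prod_ne_one {ι : Type*} {M N : ι → Type*} [∀ i, Monoid (M i)]
    [∀ i, Monoid (N i)] (f : ∀ i, M i →* N i) (w : Monoid.CoprodI.Word M)
    (hw : w ≠ Monoid.CoprodI.Word.empty) (hf : ∀ l ∈ w.toList, f l.1 l.2 ≠ 1) :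
    Monoid.CoprodI.lift (fun i => Monoid.CoprodI.of.comp (f i)) w.prod ≠
      (1 : Monoid.CoprodI N) := by
  classical
  let v : Monoid.CoprodI.Word N :=
    { toList := w.toList.map fun l => ⟨l.1, f l.1 l.2⟩
      ne_one := List.forall_mem_map.mpr hf
      chain_ne := by rw [List.isChain_map]; exact w.chain_ne }
  have hv : Monoid.CoprodI.lift (fun i => Monoid.CoprodI.of.comp (f i)) w.prod = v.prod := by
    simp [Monoid.CoprodI.Word.prod, map_list_prod, v, Function.comp_def]
  rw [hv]
  intro h
  have hve : v = Monoid.CoprodI.Word.empty :=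
    Monoid.CoprodI.Word.equiv.symm.injective (h.trans Monoid.CoprodI.Word.prod_empty.symm)
  apply hw
  have := congrArg Monoid.CoprodI.Word.toList hve
  ext1
  simpa [v, Monoid.CoprodI.Word.empty] using this

/-- A free product of countably many groups, each of which is fully residually a free group of
rank two, is itself fully residually a free group of rank two. -/
theorem Monoid.CoprodI.exists_hom_freeGroup_ne_one {ι : Type*} [Countable ι] {G : ι → Type*}
    [∀ i, Group (G i)]
    (hG : ∀ i, ∀ S : Finset (G i), (∀ s ∈ S, s ≠ 1) →
      ∃ f : G i →* FreeGroup (Fin 2), ∀ s ∈ S, f s ≠ 1)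
    (S : Finset (Monoid.CoprodI G)) (hS : ∀ s ∈ S, s ≠ 1) :
    ∃ f : Monoid.CoprodI G →* FreeGroup (Fin 2), ∀ s ∈ S, f s ≠ 1 := by
  classical
  let letters : Finset (Σ i, G i) :=
    S.biUnion fun s => (Monoid.CoprodI.Word.equiv s).toList.toFinset
  have hletters : ∀ l ∈ letters, l.2 ≠ 1 := by
    intro l hl
    simp only [letters, Finset.mem_biUnion, List.mem_toFinset] at hl
    obtain ⟨s, -, hl⟩ := hl
    exact Monoid.CoprodI.Word.ne_one _ l hl
  have hf (i : ι) : ∃ f : G i →* FreeGroup (Fin 2), ∀ g, ⟨i, g⟩ ∈ letters → f g ≠ 1 := by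
    obtain ⟨f, hf⟩ := hG i (letters.preimage (Sigma.mk i) sigma_mk_injective.injOn)
      fun g hg => hletters ⟨i, g⟩ (Finset.mem_preimage.mp hg)
    exact ⟨f, fun g hg => hf g (Finset.mem_preimage.mpr hg)⟩
  choose f hf using hf
  obtain ⟨e, he⟩ := FreeGroup.exists_injective_of_countable (Σ _ : ι, Fin 2)
  let B : FreeGroupBasis (Σ _ : ι, Fin 2) (Monoid.CoprodI fun _ : ι => FreeGroup (Fin 2)) :=
    FreeGroupBasis.coprodI fun _ => FreeGroupBasis.ofFreeGroup (Fin 2)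
  let φ : Monoid.CoprodI G →* Monoid.CoprodI fun _ : ι => FreeGroup (Fin 2) :=
    Monoid.CoprodI.lift fun i =>
      (Monoid.CoprodI.of (M := fun _ : ι => FreeGroup (Fin 2)) (i := i)).comp (f i)
  refine ⟨(e.comp B.repr.toMonoidHom).comp φ, fun s hs h => ?_⟩
  have hs1 : (Monoid.CoprodI.Word.equiv s).prod = s := Monoid.CoprodI.Word.equiv.symm_apply_apply s
  refine Monoid.CoprodI.Word.lift_prod_ne_one f (Monoid.CoprodI.Word.equiv s) ?_ ?_ ?_
  · intro h0
    rw [h0, Monoid.CoprodI.Word.prod_empty] at hs1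
    exact hS s hs hs1.symm
  · exact fun l hl => hf l.1 l.2 (Finset.mem_biUnion.mpr ⟨s, hs, List.mem_toFinset.mpr hl⟩)
  · rw [hs1]
    exact (he.comp B.repr.injective) (by simpa using h)


/-- If `G` is a finitely generated free product of groups `G i` and `π : G →* H` is a
homomorphism to a limit group `H` whose image is nonabelian and whose restriction to each
free factor is injective, then `G` is a limit group. -/
theorem free_product_isLimitGroup (ι : Type) [Finite ι] [Nonempty ι]
    (G : ι → Type) [∀ i, Group (G i)] (H : Type*) [Group H]
    (hH : IsLimitGroup H)
    (hfg : Group.FG (Monoid.CoprodI G))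
    (π : Monoid.CoprodI G →* H)
    (hnab : ∃ x ∈ π.range, ∃ y ∈ π.range, x * y ≠ y * x)
    (hinj : ∀ i : ι, Function.Injective
      (π.comp (Monoid.CoprodI.of : G i →* Monoid.CoprodI G))) :
    IsLimitGroup (Monoid.CoprodI G) := by
  classical
  refine ⟨hfg, Monoid.CoprodI.exists_hom_freeGroup_ne_one fun i S hS => ?_⟩
  obtain ⟨f, hf⟩ := hH.2 (S.image (π.comp Monoid.CoprodI.of)) (by
    simp only [Finset.forall_mem_image]
    exact fun s hs => (map_ne_one_iff _ (hinj i)).mpr (hS s hs))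
  exact ⟨f.comp (π.comp Monoid.CoprodI.of), fun s hs => hf _ (Finset.mem_image_of_mem _ hs)⟩
end

section
/- Every finitely generated residually free group is Hopfian: if G is a finitely generated group such that for every nonidentity element g of G there exists a homomorphism f from G to a free group with f(g) ≠ 1, then every surjective group homomorphism from G to itself is injective. -/
/-- The partial left translation by `a` on a finite subset of a group extends to a permutation. -/
theorem Set.Finite.exists_perm_extending_mul_left {H : Type*} [Group H] {S : Set H}
    (hS : S.Finite) (a : H) :
    ∃ σ : Equiv.Perm S, ∀ s t : S, a * (s : H) = t → σ s = t := by
  classical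
  have := hS.to_subtype
  let e : {s : S // a * (s : H) ∈ S} ≃ {t : S // a⁻¹ * (t : H) ∈ S} :=
    { toFun := fun s => ⟨⟨a * (s.1 : H), s.2⟩, by simp⟩
      invFun := fun t => ⟨⟨a⁻¹ * (t.1 : H), t.2⟩, by simp⟩
      left_inv := fun s => by simp
      right_inv := fun t => by simp }
  refine ⟨e.extendSubtype, fun s t h => ?_⟩
  have hs : a * (s : H) ∈ S := h ▸ t.2
  rw [Equiv.extendSubtype_apply_of_mem e s hs]
  exact Subtype.ext h

/-- Nontrivial elements of a free group survive in a finite quotient. -/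
theorem FreeGroup.exists_finite_hom_ne_one {α : Type*} (w : FreeGroup α) (hw : w ≠ 1) :
    ∃ (X : Set (FreeGroup α)) (_ : X.Finite) (f : FreeGroup α →* Equiv.Perm X), f w ≠ 1 := by
  obtain ⟨L, rfl⟩ := Quot.exists_rep w
  change FreeGroup.mk L ≠ 1 at hw
  let S : Set (FreeGroup α) := FreeGroup.mk '' {l | l <:+ L}
  have hS : S.Finite :=
    (L.tails.finite_toSet.subset fun l hl => (List.mem_tails l L).mpr hl).image _
  have mem {l : List (α × Bool)} (hl : l <:+ L) : FreeGroup.mk l ∈ S := ⟨l, hl, rfl⟩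
  choose σ hσ using fun a : α => hS.exists_perm_extending_mul_left (FreeGroup.of a)
  let ρ : FreeGroup α →* Equiv.Perm S := FreeGroup.lift σ
  have hρ (a : α) : ρ (FreeGroup.of a) = σ a := FreeGroup.lift_apply_of
  let e : S := ⟨1, mem List.nil_suffix⟩
  have orbit (l : List (α × Bool)) (hl : l <:+ L) :
      ρ (FreeGroup.mk l) e = ⟨FreeGroup.mk l, mem hl⟩ := by
    induction l with
    | nil => exact congrArg (fun τ : Equiv.Perm S => τ e) ρ.map_one
    | cons x l ih =>
      obtain ⟨a, b⟩ := x
      have hcons : ρ (FreeGroup.mk ((a, b) :: l)) =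
          ρ (FreeGroup.mk [(a, b)]) * ρ (FreeGroup.mk l) :=
        ρ.map_mul (FreeGroup.mk [(a, b)]) (FreeGroup.mk l)
      rw [hcons, Equiv.Perm.mul_apply, ih ((List.suffix_cons _ l).trans hl)]
      cases b with
      | true =>
        change ρ (FreeGroup.of a) _ = _
        rw [hρ]
        exact hσ a _ _ rfl
      | false =>
        change ρ (FreeGroup.of a)⁻¹ _ = _
        rw [_root_.map_inv, hρ, Equiv.Perm.inv_eq_iff_eq]
        exact (hσ a _ _ (mul_inv_cancel_left (FreeGroup.of a) (FreeGroup.mk l))).symm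
  refine ⟨S, hS, ρ, fun h => hw ?_⟩
  have hL := orbit L List.suffix_rfl
  change ρ (FreeGroup.mk L) = 1 at h
  rw [h] at hL
  exact (congrArg Subtype.val hL).symm

/-- A finitely generated group has only finitely many homomorphisms to a finite group. -/
theorem Group.FG.finite_monoidHom {G Q : Type*} [Group G] [Group Q] [Finite Q]
    (hG : Group.FG G) : Finite (G →* Q) := by
  obtain ⟨S, hS, hfin⟩ := Group.fg_iff.mp hG
  have := hfin.to_subtype
  refine Finite.of_injective (fun (f : G →* Q) (s : S) => f s) fun f g h => ?_
  exact MonoidHom.eq_of_eqOn_dense hS fun s hs => congrFun h ⟨s, hs⟩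

/-- The kernel of a surjective endomorphism of a finitely generated group is killed by every
homomorphism to a finite group. -/
theorem MonoidHom.eq_one_of_surjective_endomorphism {G Q : Type*} [Group G] [Group Q] [Finite Q]
    (hG : Group.FG G) {φ : G →* G} (hφ : Function.Surjective φ) {g : G} (hg : φ g = 1)
    (f : G →* Q) : f g = 1 := by
  have := hG.finite_monoidHom (Q := Q)
  have hinj : Function.Injective fun ψ : G →* Q => ψ.comp φ :=
    fun _ _ h => (MonoidHom.cancel_right hφ).mp h
  obtain ⟨ψ, rfl⟩ := Finite.surjective_of_injective hinj f
  simp [hg]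

/-- **Finitely generated residually free groups are Hopfian.**  If `G` is finitely generated
and for every nontrivial `g : G` there is a homomorphism `f` from `G` to a free group with
`f g ≠ 1`, then every surjective endomorphism of `G` is injective. -/
theorem residually_free_hopfian (G : Type*) [Group G] (hfg : Group.FG G)
    (hres : ∀ g : G, g ≠ 1 → ∃ (α : Type) (f : G →* FreeGroup α), f g ≠ 1)
    (φ : G →* G) (hφ : Function.Surjective φ) :
    Function.Injective φ := by
  refine (injective_iff_map_eq_one φ).mpr fun g hg => by_contra fun hne => ?_
  obtain ⟨α, f, hf⟩ := hres g hne
  obtain ⟨X, hX, p, hp⟩ := FreeGroup.exists_finite_hom_ne_one (f g) hf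
  have := hX.to_subtype
  exact hp (MonoidHom.eq_one_of_surjective_endomorphism hfg hφ hg (p.comp f))
end
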